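/- Grant Assumptions 1–4 of the paper. Then for any n ≥ 3 and any r ≥ 1, the empirical processes indexed by the matrix class ℰ* satisfy the deviation bound P(sup_{E∈ℰ*}[|η_{n,t}(E)| + |ξ_{n,t}(E)|] ≥ C₁(n)·‖F‖_∞ + C₂(n)) ≤ (8+Υ)·n^{−4r}, where ‖F‖_∞ = sup_{x∈[−5/2,5/2]²}|F(x)|, C₁(n) = 2√2·g̲^{−1/2}‖K‖²_∞√(c₁(n)) + (8/3)c₁(n)(ln n)^{−(2+ω)/(2ω)}·g̲^{−1}‖K‖²_∞ with c₁(n) = 730·ln(16n²g̲^{−1/2}[12Q+√2]) + 8r·ln(n) + 394, and C₂(n) = 2√2(σ∨1)g̲^{−1/2}‖K‖²_∞√(c₂(n)) + (8/3)c₂(n)(ln n)^{−1/2}·g̲^{−1}‖K‖²_∞·(Ω^{−1}(4r+1))^{1/ω} with c₂(n) = 730·ln(16n²τ g̲^{−1/2}[12Q+√2]) + 8r·ln(n) + 394, τ = (Ω^{−1}(4r+1)ln n)^{1/ω}, and σ² = sup_{p∈𝔓}∫x²p(x)dx. -/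

import Mathlib

open MeasureTheory Real

noncomputable section

namespace SingleIndex

/-- Inner product of two points of `ℝ²`. -/
def dot2 (a b : Fin 2 → ℝ) : ℝ := a 0 * b 0 + a 1 * b 1

/-- The unit circle `S¹ ⊂ ℝ²`. -/
def S1 : Set (Fin 2 → ℝ) := {θ | θ 0 ^ 2 + θ 1 ^ 2 = 1}

/-- The Hölder ball `F(β₀, M)`: functions with `‖f‖_∞ + Hölder seminorm ≤ M`. -/
def HolderBall (β₀ M : ℝ) : Set (ℝ → ℝ) :=
  {f | ∃ A B : ℝ, A + B ≤ M ∧ (∀ y, |f y| ≤ A) ∧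
    ∀ y₁ y₂ : ℝ, |f y₁ - f y₂| ≤ B * |y₁ - y₂| ^ β₀}

/-- Assumption 4 on the kernel `K`. -/
structure KernelHyp (K : ℝ → ℝ) (Q : ℝ) : Prop where
  supp : ∀ u : ℝ, u ∉ Set.Icc (-(1/2) : ℝ) (1/2) → K u = 0
  norm_one : ∫ u : ℝ, K u = 1
  symm : ∀ u : ℝ, K (-u) = K u
  lip : ∀ u v : ℝ, |K u - K v| ≤ Q * |u - v|

/-- `‖K‖_∞`. -/
def Ksup (K : ℝ → ℝ) : ℝ := ⨆ u : ℝ, |K u|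

/-- `‖K‖₁`. -/
def K1 (K : ℝ → ℝ) : ℝ := ∫ u : ℝ, |K u|

/-- The monotone approximation error `Δ_{K,f}(h,z)`. -/
def Delta (K f : ℝ → ℝ) (h z : ℝ) : ℝ :=
  sSup {v | ∃ δ : ℝ, 0 < δ ∧ δ ≤ h ∧
    v = |δ⁻¹ * ∫ u : ℝ, K ((u - z) / δ) * (f u - f z)|}

/-- The Hardy–Littlewood maximal function `Δ*_{K,f}(h,y)` of `Δ_{K,f}(h,·)`. -/
def DeltaStar (K f : ℝ → ℝ) (h y : ℝ) : ℝ :=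
  sSup {v | ∃ a : ℝ, 0 < a ∧
    v = (2 * a)⁻¹ * ∫ z in Set.Icc (y - a) (y + a), Delta K f h z}

/-- `h_min = n⁻¹ ln^{1+2/ω}(n)`. -/
def hmin (ω : ℝ) (n : ℕ) : ℝ := (n : ℝ)⁻¹ * Real.log n ^ ((1 : ℝ) + 2 / ω)

/-- `𝔥 = √(n⁻¹ ln^{1+1/ω}(n))`. -/
def frakh (ω : ℝ) (n : ℕ) : ℝ := Real.sqrt ((n : ℝ)⁻¹ * Real.log n ^ ((1 : ℝ) + 1 / ω))

/-- The oracle bandwidth `h*_{K,f}(y)`. -/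
def hstar (K f : ℝ → ℝ) (ω : ℝ) (n : ℕ) (y : ℝ) : ℝ :=
  sSup {h | h ∈ Set.Icc (hmin ω n) 1 ∧
    Real.sqrt (n * h) * DeltaStar K f h y ≤ Ksup K * Real.sqrt (Real.log n)}

/-- The minimal sample size `n₀`. -/
def n0 (β₀ M ω : ℝ) : ℕ :=
  sInf {m : ℕ | 1 ≤ m ∧ ∀ n : ℕ, m ≤ n →
    max M 1 * max (frakh ω n ^ β₀) (Real.log n ^ ((1 : ℝ) / ω) * hmin ω n ^ β₀) ≤ 1}

/-- The noise class `𝔓` (Assumption 1): symmetric densities with the prescribed tail bound. -/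
def NoiseClass (Υ Ωc ω : ℝ) : Set (ℝ → ℝ) :=
  {p | (∀ y, 0 ≤ p y) ∧ (∫ y : ℝ, p y = 1) ∧ (∀ y, p (-y) = p y) ∧
    ∀ x : ℝ, 0 ≤ x → ∫ y in Set.Ici x, p y ≤ Υ * Real.exp (-Ωc * x ^ ω)}

/-- Assumption 2 on the design density `g`: a density bounded below by `gl` on `[-3,3]²`. -/
def DesignOK (g : (Fin 2 → ℝ) → ℝ) (gl : ℝ) : Prop :=
  (∀ x, 0 ≤ g x) ∧ (∫ x : Fin 2 → ℝ, g x = 1) ∧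
    ∀ x ∈ Set.Icc (fun _ : Fin 2 => (-3 : ℝ)) (fun _ : Fin 2 => (3 : ℝ)), gl ≤ g x

/-- Two-dimensional product kernel `K(u,v) = K(u)K(v)`. -/
def K2 (K : ℝ → ℝ) (v : Fin 2 → ℝ) : ℝ := K (v 0) * K (v 1)

/-- The matrix `E_{(θ,h)}`. -/
def Emat (θ : Fin 2 → ℝ) (h : ℝ) : Matrix (Fin 2) (Fin 2) ℝ :=
  !![θ 0 / h, θ 1 / h; -θ 1, θ 0]

/-- The matrix `Ē_{(θ,h)(ν,h)}`. -/
def Ebar (θ ν : Fin 2 → ℝ) (h : ℝ) : Matrix (Fin 2) (Fin 2) ℝ :=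
  !![(θ 0 + ν 0) / (2 * h * (1 + |dot2 ν θ|)), (θ 1 + ν 1) / (2 * h * (1 + |dot2 ν θ|));
     -((θ 1 + ν 1) / (2 * (1 + |dot2 ν θ|))), (θ 0 + ν 0) / (2 * (1 + |dot2 ν θ|))]

/-- The matrix `E_{(θ,h)(ν,h)}` with the sign convention. -/
def Epair (θ ν : Fin 2 → ℝ) (h : ℝ) : Matrix (Fin 2) (Fin 2) ℝ :=
  if 0 ≤ dot2 ν θ then Ebar θ ν h else Ebar (-θ) ν h

/-- Generic kernel estimator associated with a matrix `E`, as a function of the data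
`d : Fin n → (ℝ² × ℝ)`, `X_i = (d i).1`, `Y_i = (d i).2`. -/
def estM (K : ℝ → ℝ) (g : (Fin 2 → ℝ) → ℝ) (n : ℕ)
    (E : Matrix (Fin 2) (Fin 2) ℝ) (t : Fin 2 → ℝ)
    (d : Fin n → (Fin 2 → ℝ) × ℝ) : ℝ :=
  (E.det / n) * ∑ i : Fin n, K2 K (E.mulVec ((d i).1 - t)) * (d i).2 / g ((d i).1)

/-- Joint law of a single observation `(X_i, Y_i)` where `Y_i = F(X_i) + ε_i`:
density `g(x) p(y - F(x))` w.r.t. Lebesgue measure on `ℝ² × ℝ`. -/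
def jointLaw (g : (Fin 2 → ℝ) → ℝ) (p : ℝ → ℝ) (F : (Fin 2 → ℝ) → ℝ) :
    Measure ((Fin 2 → ℝ) × ℝ) :=
  volume.withDensity fun z => ENNReal.ofReal (g z.1 * p (z.2 - F z.1))

/-- Law `P_F^{(n)}` of the i.i.d. sample `(X_1,Y_1),…,(X_n,Y_n)`. -/
def dataLaw (n : ℕ) (g : (Fin 2 → ℝ) → ℝ) (p : ℝ → ℝ) (F : (Fin 2 → ℝ) → ℝ) :
    Measure (Fin n → (Fin 2 → ℝ) × ℝ) :=
  Measure.pi fun _ => jointLaw g p F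

end SingleIndex
namespace SingleIndex

/-- Parameters of the model and of the procedure. -/
structure Pars where
  /-- the univariate kernel -/
  K : ℝ → ℝ
  /-- Lipschitz constant of the kernel -/
  Q : ℝ
  /-- the design density -/
  g : (Fin 2 → ℝ) → ℝ
  /-- lower bound of `g` on `[-3,3]²` -/
  gl : ℝ
  /-- tail constant of the noise class -/
  Υ : ℝ
  /-- tail exponent constant `Ω` of the noise class -/
  Ωc : ℝ
  /-- tail power `ω` of the noise class -/
  ω : ℝ
  /-- order of the risk -/
  r : ℝ

/-- `σ² = sup_{p ∈ 𝔓} ∫ x² p(x) dx`. -/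
def sigma2 (P : Pars) : ℝ :=
  sSup {v | ∃ p ∈ NoiseClass P.Υ P.Ωc P.ω, v = ∫ x : ℝ, x ^ 2 * p x}

/-- `τ = (Ω⁻¹(4r+1) ln n)^{1/ω}`. -/
def tauf (P : Pars) (n : ℕ) : ℝ := (P.Ωc⁻¹ * (4 * P.r + 1) * Real.log n) ^ ((1 : ℝ) / P.ω)

/-- The quantity `c₁(n)`. -/
def c1f (P : Pars) (n : ℕ) : ℝ :=
  730 * Real.log (16 * (n : ℝ) ^ 2 * P.gl ^ (-(1/2) : ℝ) * (12 * P.Q + Real.sqrt 2))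
    + 8 * P.r * Real.log n + 394

/-- The quantity `c₂(n)`. -/
def c2f (P : Pars) (n : ℕ) : ℝ :=
  730 * Real.log (16 * (n : ℝ) ^ 2 * tauf P n * P.gl ^ (-(1/2) : ℝ) * (12 * P.Q + Real.sqrt 2))
    + 8 * P.r * Real.log n + 394

/-- The quantity `c₃(n)`. -/
def c3f (P : Pars) (n : ℕ) : ℝ :=
  365 * Real.log (5 * (n : ℝ) ^ 2 * P.Q * P.gl ^ (-(1/2) : ℝ)) + 8 * P.r * Real.log n + 197

/-- The quantity `c₄(n)`. -/
def c4f (P : Pars) (n : ℕ) : ℝ :=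
  365 * Real.log (5 * (n : ℝ) ^ 2 * tauf P n * P.Q * P.gl ^ (-(1/2) : ℝ))
    + 8 * P.r * Real.log n + 197

/-- The constant `C₁(n)`. -/
def C1f (P : Pars) (n : ℕ) : ℝ :=
  2 * Real.sqrt 2 * P.gl ^ (-(1/2) : ℝ) * Ksup P.K ^ 2 * Real.sqrt (c1f P n)
    + 8 / 3 * c1f P n * Real.log n ^ (-((2 + P.ω) / (2 * P.ω))) * P.gl⁻¹ * Ksup P.K ^ 2

/-- The constant `C₂(n)`. -/
def C2f (P : Pars) (n : ℕ) : ℝ :=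
  2 * Real.sqrt 2 * max (Real.sqrt (sigma2 P)) 1 * P.gl ^ (-(1/2) : ℝ) * Ksup P.K ^ 2
      * Real.sqrt (c2f P n)
    + 8 / 3 * c2f P n * Real.log n ^ (-(1/2) : ℝ) * P.gl⁻¹ * Ksup P.K ^ 2
      * (P.Ωc⁻¹ * (4 * P.r + 1)) ^ ((1 : ℝ) / P.ω)

/-- The constant `C₃(n)`. -/
def C3f (P : Pars) (n : ℕ) : ℝ :=
  2 * Real.sqrt 2 * P.gl ^ (-(1/2) : ℝ) * Ksup P.K ^ 2 * Real.sqrt (c3f P n)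
    + 8 / 3 * P.gl⁻¹ * Ksup P.K ^ 2 * c3f P n * ((n : ℝ) * frakh P.ω n ^ 2) ^ (-(1/2) : ℝ)

/-- The constant `C₄(n)`. -/
def C4f (P : Pars) (n : ℕ) : ℝ :=
  2 * Real.sqrt 2 * max (Real.sqrt (sigma2 P)) 1 * P.gl ^ (-(1/2) : ℝ) * Ksup P.K ^ 2
      * Real.sqrt (c4f P n)
    + 8 / 3 * tauf P n * c4f P n * ((n : ℝ) * frakh P.ω n ^ 2) ^ (-(1/2) : ℝ)
      * P.gl⁻¹ * Ksup P.K ^ 2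

/-- The constant `C₅(n)`. -/
def C5f (P : Pars) (n : ℕ) : ℝ :=
  K1 P.K ^ 2 + ((n : ℝ) * frakh P.ω n ^ 2) ^ (-(1/2) : ℝ) * C4f P n + 1 / 2

/-- `n₁`: the minimal sample size linked to `(n𝔥²)^{-1/2} C₃(n) ≤ 1/2`. -/
def n1 (P : Pars) : ℕ :=
  sInf {m : ℕ | 1 ≤ m ∧ ∀ n : ℕ, m ≤ n →
    ((n : ℝ) * frakh P.ω n ^ 2) ^ (-(1/2) : ℝ) * C3f P n ≤ 1 / 2}

/-- The auxiliary estimator `F̂(v)` with bandwidth `𝔥`. -/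
def FhatAux (P : Pars) (n : ℕ) (d : Fin n → (Fin 2 → ℝ) × ℝ) (v : Fin 2 → ℝ) : ℝ :=
  (n : ℝ)⁻¹ * ∑ i : Fin n, (P.g ((d i).1))⁻¹ * (frakh P.ω n) ^ (-2 : ℤ) *
    P.K (((d i).1 0 - v 0) / frakh P.ω n) * P.K (((d i).1 1 - v 1) / frakh P.ω n) * (d i).2

/-- `F̂_∞ = 2 sup_{v ∈ [-5/2,5/2]²} |F̂(v)| + 2C₅(n)`. -/
def FhatInf (P : Pars) (n : ℕ) (d : Fin n → (Fin 2 → ℝ) × ℝ) : ℝ :=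
  2 * sSup {w | ∃ v ∈ Set.Icc (fun _ : Fin 2 => -(5/2 : ℝ)) (fun _ : Fin 2 => (5/2 : ℝ)),
      w = |FhatAux P n d v|}
    + 2 * C5f P n

/-- The random threshold `TH(η)`. -/
def TH (P : Pars) (n : ℕ) (d : Fin n → (Fin 2 → ℝ) × ℝ) (η : ℝ) : ℝ :=
  2 * (Ksup P.K ^ 2 * Real.sqrt (Real.log n) + FhatInf P n d * C1f P n + C2f P n)
    * (η * n) ^ (-(1/2) : ℝ)

/-- The dyadic bandwidth grid `H_n = {2^{-k} : k ∈ ℕ} ∩ [h_min/2, 1]`. -/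
def Hgrid (ω : ℝ) (n : ℕ) : Set ℝ :=
  {h | (∃ k : ℕ, h = (2 : ℝ) ^ (-(k : ℤ))) ∧ hmin ω n / 2 ≤ h ∧ h ≤ 1}

/-- The quantity `R^{(1)}_t(θ,h)`. -/
def R1 (P : Pars) (n : ℕ) (t : Fin 2 → ℝ) (θ : Fin 2 → ℝ) (h : ℝ)
    (d : Fin n → (Fin 2 → ℝ) × ℝ) : ℝ :=
  sSup {v | ∃ η ∈ Hgrid P.ω n, η ≤ h ∧
    v = max (sSup {w | ∃ ν ∈ S1,
          w = |estM P.K P.g n (Epair θ ν η) t d - estM P.K P.g n (Emat ν η) t d|}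
        - TH P n d η) 0}

/-- The quantity `R^{(2)}_t(h)`. -/
def R2 (P : Pars) (n : ℕ) (t : Fin 2 → ℝ) (h : ℝ)
    (d : Fin n → (Fin 2 → ℝ) × ℝ) : ℝ :=
  sSup {v | ∃ η ∈ Hgrid P.ω n, η ≤ h ∧
    v = max (sSup {w | ∃ θ ∈ S1,
          w = |estM P.K P.g n (Emat θ h) t d - estM P.K P.g n (Emat θ η) t d|}
        - TH P n d η) 0}

/-- `(θ̂, ĥ)`, as a function of the data, is a solution of the minimization problem
(2.5) defining the selection rule at the point `t`. -/
def IsSelector (P : Pars) (n : ℕ) (t : Fin 2 → ℝ)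
    (sel : (Fin n → (Fin 2 → ℝ) × ℝ) → (Fin 2 → ℝ) × ℝ) : Prop :=
  ∀ d, (sel d).1 ∈ S1 ∧ (sel d).2 ∈ Hgrid P.ω n ∧
    ∀ θ ∈ S1, ∀ h ∈ Hgrid P.ω n,
      R1 P n t (sel d).1 (sel d).2 d + R2 P n t (sel d).2 d + TH P n d (sel d).2
        ≤ R1 P n t θ h d + R2 P n t h d + TH P n d h

/-- The selected estimator `F̂_{(θ̂,ĥ)}(t)` as a function of the data. -/
def selEst (P : Pars) (n : ℕ) (t : Fin 2 → ℝ)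
    (sel : (Fin n → (Fin 2 → ℝ) × ℝ) → (Fin 2 → ℝ) × ℝ)
    (d : Fin n → (Fin 2 → ℝ) × ℝ) : ℝ :=
  estM P.K P.g n (Emat (sel d).1 (sel d).2) t d

end SingleIndex

namespace SingleIndex

/-- The matrix class `ℰ_{a,A}`: `|det E| ≤ A` and `|E|_∞ ≤ (√(2a))⁻¹ |det E|`. -/
def Ecal (a A : ℝ) : Set (Matrix (Fin 2) (Fin 2) ℝ) :=
  {E | |E.det| ≤ A ∧ ∀ i j : Fin 2, |E i j| ≤ (Real.sqrt (2 * a))⁻¹ * |E.det|}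

/-- `J(x,E) = √|det E| K(E(x-t)) g(x)⁻¹`. -/
def Jfun (P : Pars) (t : Fin 2 → ℝ) (E : Matrix (Fin 2) (Fin 2) ℝ)
    (x : Fin 2 → ℝ) : ℝ :=
  Real.sqrt |E.det| * K2 P.K (E.mulVec (x - t)) * (P.g x)⁻¹

/-- The centered empirical process `η_{n,t}(E)` (as a function of the data). -/
def etaProc (P : Pars) (n : ℕ) (t : Fin 2 → ℝ) (F : (Fin 2 → ℝ) → ℝ)
    (E : Matrix (Fin 2) (Fin 2) ℝ) (d : Fin n → (Fin 2 → ℝ) × ℝ) : ℝ :=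
  (n : ℝ) ^ (-(1/2) : ℝ) * ∑ i : Fin n,
    (Jfun P t E ((d i).1) * F ((d i).1) - ∫ x : Fin 2 → ℝ, Jfun P t E x * F x * P.g x)

/-- The noise empirical process `ξ_{n,t}(E)` (as a function of the data,
with `ε_i = Y_i - F(X_i)`). -/
def xiProc (P : Pars) (n : ℕ) (t : Fin 2 → ℝ) (F : (Fin 2 → ℝ) → ℝ)
    (E : Matrix (Fin 2) (Fin 2) ℝ) (d : Fin n → (Fin 2 → ℝ) × ℝ) : ℝ :=
  (n : ℝ) ^ (-(1/2) : ℝ) * ∑ i : Fin n,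
    Jfun P t E ((d i).1) * ((d i).2 - F ((d i).1))

/-- `‖F‖_∞ = sup_{x ∈ [-5/2,5/2]²} |F(x)|`. -/
def FsupNorm (F : (Fin 2 → ℝ) → ℝ) : ℝ :=
  sSup {w | ∃ x ∈ Set.Icc (fun _ : Fin 2 => -(5/2 : ℝ)) (fun _ : Fin 2 => (5/2 : ℝ)),
    w = |F x|}

theorem exp_le_one_add_add_two_mul_sq {y : ℝ} (hy : y ≤ 3) :
    Real.exp y ≤ 1 + y + 2 * y ^ 2 := by
  rcases le_total y (-1) with h1 | h1
  · have : Real.exp y ≤ 1 := Real.exp_le_one_iff.2 (by linarith)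
    nlinarith
  rcases le_total y 1 with h2 | h2
  · have := abs_le.1 (Real.abs_exp_sub_one_sub_id_le (abs_le.2 ⟨h1, h2⟩))
    nlinarith [sq_nonneg y]
  have e1 : Real.exp 1 < 2.7182818286 := Real.exp_one_lt_d9
  have e0 : 2.7182818283 < Real.exp 1 := Real.exp_one_gt_d9
  have e2 : Real.exp 2 = Real.exp 1 ^ 2 := by rw [← Real.exp_nat_mul]; norm_num
  have e3 : Real.exp 3 = Real.exp 1 ^ 3 := by rw [← Real.exp_nat_mul]; norm_num
  have b2 : Real.exp 2 < 7.39 := by rw [e2]; nlinarith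
  have b3 : Real.exp 3 < 20.1 := by
    have : Real.exp 1 ^ 3 = Real.exp 2 * Real.exp 1 := by rw [e2]; ring
    rw [e3, this]; nlinarith [Real.exp_pos 2, Real.exp_pos 1]
  have chord : ∀ a : ℝ, a ≤ y → y ≤ a + 1 →
      Real.exp y ≤ (a + 1 - y) * Real.exp a + (y - a) * Real.exp (a + 1) := by
    intro a h h'
    have := convexOn_exp.2 (Set.mem_univ a) (Set.mem_univ (a + 1))
      (show 0 ≤ a + 1 - y by linarith) (show 0 ≤ y - a by linarith) (by ring)
    simp only [smul_eq_mul] at this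
    rwa [show (a + 1 - y) * a + (y - a) * (a + 1) = y by ring] at this
  rcases le_total y 2 with h3 | h3
  · have := chord 1 h2 (by linarith)
    norm_num at this
    nlinarith [sq_nonneg (y - 1)]
  · have := chord 2 h3 (by linarith)
    norm_num at this
    nlinarith [sq_nonneg (y - 3)]

section Bernstein

variable {Z : Type*} [MeasurableSpace Z] {μ : Measure Z} [IsProbabilityMeasure μ]

theorem integral_exp_mul_le {W : Z → ℝ} (hW : AEMeasurable W μ) {b v l : ℝ}
    (hb : ∀ z, |W z| ≤ b) (hm : ∫ z, W z ∂μ = 0) (hv : ∫ z, W z ^ 2 ∂μ ≤ v ^ 2)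
    (hl : 0 ≤ l) (hlb : l * b ≤ 3) :
    Integrable (fun z => Real.exp (l * W z)) μ ∧
      ∫ z, Real.exp (l * W z) ∂μ ≤ Real.exp (2 * l ^ 2 * v ^ 2) := by
  have iW : Integrable W μ := by
    refine Integrable.of_bound hW.aestronglyMeasurable b (Filter.Eventually.of_forall fun z => ?_)
    simpa using hb z
  have iW2 : Integrable (fun z => W z ^ 2) μ := by
    refine Integrable.of_bound (hW.pow_const 2).aestronglyMeasurable (b ^ 2)
      (Filter.Eventually.of_forall fun z => ?_)
    rw [Real.norm_eq_abs, abs_pow]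
    exact pow_le_pow_left₀ (abs_nonneg _) (hb z) 2
  have hle : ∀ z, l * W z ≤ 3 := fun z =>
    (mul_le_mul_of_nonneg_left ((le_abs_self _).trans (hb z)) hl).trans hlb
  have iexp : Integrable (fun z => Real.exp (l * W z)) μ := by
    refine Integrable.of_bound (Real.measurable_exp.comp_aemeasurable
      (hW.const_mul l)).aestronglyMeasurable (Real.exp 3)
      (Filter.Eventually.of_forall fun z => ?_)
    rw [Real.norm_eq_abs, Real.abs_exp]
    exact Real.exp_le_exp.2 (hle z)
  refine ⟨iexp, ?_⟩
  calc ∫ z, Real.exp (l * W z) ∂μ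
      ≤ ∫ z, (1 + l * W z + 2 * l ^ 2 * W z ^ 2) ∂μ := by
        refine integral_mono iexp ?_ fun z => ?_
        · exact ((integrable_const _).add (iW.const_mul l)).add (iW2.const_mul _)
        · have := exp_le_one_add_add_two_mul_sq (hle z)
          nlinarith
    _ = 1 + 2 * l ^ 2 * ∫ z, W z ^ 2 ∂μ := by
        have h1 : Integrable (fun z => 1 + l * W z) μ := (integrable_const _).add (iW.const_mul l)
        rw [integral_add h1 (iW2.const_mul _),
          integral_add (integrable_const _) (iW.const_mul l), integral_const_mul,
          integral_const_mul, hm]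
        simp
    _ ≤ 2 * l ^ 2 * v ^ 2 + 1 := by
        have := mul_le_mul_of_nonneg_left hv (by positivity : 0 ≤ 2 * l ^ 2)
        linarith
    _ ≤ _ := Real.add_one_le_exp _

theorem measure_sum_ge_le {n : ℕ} (hn : 0 < n) {W : Z → ℝ} (hW : AEMeasurable W μ) {b v c : ℝ}
    (hb0 : 0 < b) (hv0 : 0 < v) (hc : 0 < c)
    (hb : ∀ z, |W z| ≤ b) (hm : ∫ z, W z ∂μ = 0) (hv : ∫ z, W z ^ 2 ∂μ ≤ v ^ 2) :
    (Measure.pi fun _ : Fin n => μ).real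
        {d | 2 * v * √n * √c + b * c / 6 ≤ ∑ i, W (d i)} ≤ Real.exp (-(c / 2)) := by
  have hn' : (0 : ℝ) < n := by exact_mod_cast hn
  set l : ℝ := min (3 / b) (√c / (2 * √n * v)) with hldef
  have hl : 0 ≤ l := le_min (by positivity) (by positivity)
  have hlb : l * b ≤ 3 := by
    calc l * b ≤ 3 / b * b := mul_le_mul_of_nonneg_right (min_le_left _ _) hb0.le
      _ = 3 := by field_simp
  obtain ⟨iexp, hexp⟩ := integral_exp_mul_le hW hb hm hv hl hlb
  have hprod : ∀ d : Fin n → Z, Real.exp (l * ∑ i, W (d i)) = ∏ i, Real.exp (l * W (d i)) := by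
    intro d
    rw [Finset.mul_sum, Real.exp_sum]
  have key := ProbabilityTheory.measure_ge_le_exp_mul_mgf
    (μ := Measure.pi fun _ : Fin n => μ) (X := fun d => ∑ i, W (d i))
    (2 * v * √n * √c + b * c / 6) hl (by
      simp only [hprod]
      exact Integrable.fintype_prod (f := fun (_ : Fin n) z => Real.exp (l * W z)) fun _ => iexp)
  refine key.trans ?_
  rw [ProbabilityTheory.mgf]
  simp only [hprod]
  rw [integral_fintype_prod_eq_pow (ι := Fin n) (fun z => Real.exp (l * W z)), Fintype.card_fin]
  calc _ ≤ Real.exp (-l * (2 * v * √n * √c + b * c / 6)) * Real.exp (2 * l ^ 2 * v ^ 2) ^ n := by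
        refine mul_le_mul_of_nonneg_left ?_ (Real.exp_pos _).le
        exact pow_le_pow_left₀ (integral_nonneg fun z => (Real.exp_pos _).le) hexp n
    _ = Real.exp (-l * (2 * v * √n * √c + b * c / 6) + n * (2 * l ^ 2 * v ^ 2)) := by
        rw [← Real.exp_nat_mul, ← Real.exp_add]
    _ ≤ _ := by
        refine Real.exp_le_exp.2 ?_
        have hsn : √(n : ℝ) ^ 2 = n := Real.sq_sqrt hn'.le
        have hsc : √c ^ 2 = c := Real.sq_sqrt hc.le
        have hsn0 : 0 < √(n : ℝ) := Real.sqrt_pos.2 hn'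
        have hsc0 : 0 < √c := Real.sqrt_pos.2 hc
        have hlq : l * (2 * √n * v) ≤ √c := by
          calc l * (2 * √n * v) ≤ √c / (2 * √n * v) * (2 * √n * v) :=
                mul_le_mul_of_nonneg_right (min_le_right _ _) (by positivity)
            _ = √c := by field_simp
        have hquad : n * (2 * l ^ 2 * v ^ 2) ≤ l * v * √n * √c := by
          have : n * (2 * l ^ 2 * v ^ 2) = (l * v * √n) * (l * (2 * √n * v)) := by
            linear_combination (-2 * l ^ 2 * v ^ 2) * hsn
          rw [this]
          exact mul_le_mul_of_nonneg_left hlq (by positivity)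
        rcases min_choice (3 / b) (√c / (2 * √n * v)) with h | h
        · have h3 : l * b = 3 := by rw [hldef, h]; field_simp
          have : l * (b * c / 6) = c / 2 := by
            rw [show l * (b * c / 6) = (l * b) * c / 6 by ring, h3]; ring
          have h4 : 0 ≤ l * v * √n * √c := by positivity
          nlinarith
        · have h3 : l * (2 * √n * v) = √c := by rw [hldef, h]; field_simp
          have : l * v * √n * √c = c / 2 := by
            linear_combination √c / 2 * h3 + hsc / 2
          have h4 : 0 ≤ l * (b * c / 6) := by positivity
          nlinarith

theorem measure_abs_sum_ge_le {n : ℕ} (hn : 0 < n) {W : Z → ℝ} (hW : AEMeasurable W μ)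
    {b v c : ℝ} (hb0 : 0 < b) (hv0 : 0 < v) (hc : 0 < c)
    (hb : ∀ z, |W z| ≤ b) (hm : ∫ z, W z ∂μ = 0) (hv : ∫ z, W z ^ 2 ∂μ ≤ v ^ 2) :
    (Measure.pi fun _ : Fin n => μ).real
        {d | 2 * v * √n * √c + b * c / 6 ≤ |∑ i, W (d i)|} ≤ 2 * Real.exp (-(c / 2)) := by
  have h1 := measure_sum_ge_le hn hW hb0 hv0 hc hb hm hv
  have h2 := measure_sum_ge_le (μ := μ) hn hW.neg hb0 hv0 hc (W := -W) (by simpa using hb)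
    (by simp [integral_neg, hm]) (by simpa using hv)
  have hsub : {d : Fin n → Z | 2 * v * √n * √c + b * c / 6 ≤ |∑ i, W (d i)|} ⊆
      {d | 2 * v * √n * √c + b * c / 6 ≤ ∑ i, W (d i)} ∪
      {d | 2 * v * √n * √c + b * c / 6 ≤ ∑ i, (-W) (d i)} := by
    intro d hd
    simpa [le_abs] using hd
  calc _ ≤ _ := measureReal_mono hsub
    _ ≤ _ := measureReal_union_le _ _
    _ ≤ _ := by linarith

end Bernstein

section Kernel

variable {K : ℝ → ℝ} {Q : ℝ}

theorem KernelHyp.Q_nonneg (hK : KernelHyp K Q) : 0 ≤ Q := by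
  have := hK.lip 0 1
  have h := abs_nonneg (K 0 - K 1)
  norm_num at this
  linarith

theorem KernelHyp.abs_le_two_mul (hK : KernelHyp K Q) (u : ℝ) : |K u| ≤ 2 * Q := by
  have hQ := hK.Q_nonneg
  by_cases hu : u ∈ Set.Icc (-(1/2) : ℝ) (1/2)
  · have h := hK.lip u (3/2)
    rw [hK.supp (3/2) (by norm_num), sub_zero] at h
    have : |u - 3/2| ≤ 2 := by
      rw [abs_le]; constructor <;> linarith [hu.1, hu.2]
    nlinarith
  · rw [hK.supp u hu]; simpa using hQ

theorem KernelHyp.bddAbove (hK : KernelHyp K Q) : BddAbove (Set.range fun u => |K u|) :=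
  ⟨2 * Q, by rintro _ ⟨u, rfl⟩; exact hK.abs_le_two_mul u⟩

theorem KernelHyp.abs_le_Ksup (hK : KernelHyp K Q) (u : ℝ) : |K u| ≤ Ksup K :=
  le_ciSup hK.bddAbove u

theorem KernelHyp.Ksup_le (hK : KernelHyp K Q) : Ksup K ≤ 2 * Q :=
  ciSup_le hK.abs_le_two_mul

theorem KernelHyp.continuous (hK : KernelHyp K Q) : Continuous K := by
  refine (LipschitzWith.of_dist_le_mul (K := ⟨Q, hK.Q_nonneg⟩) fun u v => ?_).continuous
  rw [Real.dist_eq, Real.dist_eq]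
  exact hK.lip u v

theorem KernelHyp.one_le_Ksup (hK : KernelHyp K Q) : 1 ≤ Ksup K := by
  have h1 : ∫ u, K u = ∫ u in Set.Icc (-(1/2) : ℝ) (1/2), K u := by
    refine (setIntegral_eq_integral_of_forall_compl_eq_zero fun u hu => hK.supp u hu).symm
  rw [hK.norm_one] at h1
  have h2 := norm_setIntegral_le_of_norm_le_const (μ := volume)
    (s := Set.Icc (-(1/2) : ℝ) (1/2)) (f := K) (C := Ksup K) (by simp)
    (fun u _ => hK.abs_le_Ksup u)
  rw [← h1] at h2
  norm_num at h2
  exact h2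

theorem KernelHyp.abs_K2_le (hK : KernelHyp K Q) (v : Fin 2 → ℝ) : |K2 K v| ≤ Ksup K ^ 2 := by
  rw [K2, abs_mul, sq]
  exact mul_le_mul (hK.abs_le_Ksup _) (hK.abs_le_Ksup _) (abs_nonneg _)
    ((abs_nonneg _).trans (hK.abs_le_Ksup 0))

theorem KernelHyp.continuous_K2 (hK : KernelHyp K Q) : Continuous (K2 K) := by
  have := hK.continuous
  unfold K2
  fun_prop

theorem KernelHyp.mem_of_K2_ne_zero (hK : KernelHyp K Q) {v : Fin 2 → ℝ} (hv : K2 K v ≠ 0)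
    (i : Fin 2) : |v i| ≤ 1 / 2 := by
  by_contra h
  refine hv ?_
  have : K (v i) = 0 := hK.supp _ fun hm => h (abs_le.2 hm)
  fin_cases i <;> simp_all [K2]

theorem KernelHyp.abs_K2_sub_le (hK : KernelHyp K Q) (u v : Fin 2 → ℝ) :
    |K2 K u - K2 K v| ≤ Ksup K * Q * (|u 0 - v 0| + |u 1 - v 1|) := by
  have : K2 K u - K2 K v = K (u 0) * (K (u 1) - K (v 1)) + K (v 1) * (K (u 0) - K (v 0)) := by
    simp only [K2]; ring
  have hs : 0 ≤ Ksup K := (abs_nonneg _).trans (hK.abs_le_Ksup 0)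
  rw [this]
  refine (abs_add_le _ _).trans ?_
  rw [abs_mul, abs_mul]
  have h1 := mul_le_mul (hK.abs_le_Ksup (u 0)) (hK.lip (u 1) (v 1)) (abs_nonneg _) hs
  have h2 := mul_le_mul (hK.abs_le_Ksup (v 1)) (hK.lip (u 0) (v 0)) (abs_nonneg _) hs
  linarith

end Kernel

section Weight

variable {P : Pars} {t : Fin 2 → ℝ} {A : ℝ} {E E' : Matrix (Fin 2) (Fin 2) ℝ}

/-- The square `[-5/2, 5/2]²`. -/
abbrev box : Set (Fin 2 → ℝ) :=
  Set.Icc (fun _ : Fin 2 => -(5/2 : ℝ)) (fun _ : Fin 2 => (5/2 : ℝ))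

theorem abs_entry_le (hE : E ∈ Ecal (1/8) A) (i j : Fin 2) : |E i j| ≤ 2 * |E.det| := by
  have h := hE.2 i j
  have : √(2 * (1/8) : ℝ) = 1 / 2 := by
    rw [show (2 * (1/8) : ℝ) = (1/2) ^ 2 by norm_num]
    exact Real.sqrt_sq (by norm_num)
  rw [this] at h
  norm_num at h
  exact h

theorem eq_zero_or_le_abs_det (hE : E ∈ Ecal (1/8) A) : E = 0 ∨ 1 / 8 ≤ |E.det| := by
  rcases eq_or_ne E.det 0 with h | h
  · left
    ext i j
    have := abs_entry_le hE i j
    rw [h] at this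
    simpa using this
  · right
    have hd : 0 < |E.det| := abs_pos.2 h
    have h1 : |E.det| ≤ |E 0 0| * |E 1 1| + |E 0 1| * |E 1 0| := by
      rw [Matrix.det_fin_two]
      refine (abs_sub _ _).trans ?_
      rw [abs_mul, abs_mul]
    have h2 := mul_le_mul (abs_entry_le hE 0 0) (abs_entry_le hE 1 1) (abs_nonneg _) (by positivity)
    have h3 := mul_le_mul (abs_entry_le hE 0 1) (abs_entry_le hE 1 0) (abs_nonneg _) (by positivity)
    have h4 : |E.det| * 1 ≤ |E.det| * (8 * |E.det|) := by nlinarith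
    have := le_of_mul_le_mul_left h4 hd
    linarith

theorem mem_box_of_Jfun_ne_zero (hK : KernelHyp P.K P.Q) (ht : ∀ i, |t i| ≤ 1 / 2)
    (hE : E ∈ Ecal (1/8) A) {x : Fin 2 → ℝ} (hx : Jfun P t E x ≠ 0) : x ∈ box := by
  have hd : 0 < |E.det| := by
    by_contra h
    have : |E.det| = 0 := le_antisymm (not_lt.1 h) (abs_nonneg _)
    simp [Jfun, this] at hx
  have hk : K2 P.K (E.mulVec (x - t)) ≠ 0 := by
    exact fun h => hx (by rw [Jfun, h]; ring)
  have u0 := hK.mem_of_K2_ne_zero hk 0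
  have u1 := hK.mem_of_K2_ne_zero hk 1
  set u := E.mulVec (x - t) with hu
  have e0 : u 0 = E 0 0 * (x 0 - t 0) + E 0 1 * (x 1 - t 1) := by
    simp [hu]
  have e1 : u 1 = E 1 0 * (x 0 - t 0) + E 1 1 * (x 1 - t 1) := by
    simp [hu]
  have key : ∀ (a b y : ℝ), |a| ≤ 2 * |E.det| → |b| ≤ 2 * |E.det| →
      E.det * y = a * u 0 + b * u 1 → |y| ≤ 2 := by
    intro a b y ha hb h
    have h1 : |E.det| * |y| ≤ |a| * |u 0| + |b| * |u 1| := by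
      rw [← abs_mul, h]
      refine (abs_add_le _ _).trans ?_
      rw [abs_mul, abs_mul]
    have h2 := mul_le_mul ha u0 (abs_nonneg _) (by positivity)
    have h3 := mul_le_mul hb u1 (abs_nonneg _) (by positivity)
    exact le_of_mul_le_mul_left (by linarith : |E.det| * |y| ≤ |E.det| * 2) hd
  have y0 : |x 0 - t 0| ≤ 2 := key (E 1 1) (-E 0 1) _ (abs_entry_le hE 1 1)
    (by rw [abs_neg]; exact abs_entry_le hE 0 1) (by rw [e0, e1, Matrix.det_fin_two]; ring)
  have y1 : |x 1 - t 1| ≤ 2 := key (-E 1 0) (E 0 0) _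
    (by rw [abs_neg]; exact abs_entry_le hE 1 0) (abs_entry_le hE 0 0)
    (by rw [e0, e1, Matrix.det_fin_two]; ring)
  have ht0 := abs_le.1 (ht 0)
  have ht1 := abs_le.1 (ht 1)
  rw [abs_le] at y0 y1
  constructor
  · intro i
    fin_cases i
    · simp only [Fin.zero_eta]; linarith [y0.1, ht0.1]
    · simp only [Fin.mk_one]; linarith [y1.1, ht1.1]
  · intro i
    fin_cases i
    · simp only [Fin.zero_eta]; linarith [y0.2, ht0.2]
    · simp only [Fin.mk_one]; linarith [y1.2, ht1.2]

theorem le_g_of_mem_box {g : (Fin 2 → ℝ) → ℝ} {gl : ℝ} (hg : DesignOK g gl) {x : Fin 2 → ℝ}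
    (hx : x ∈ box) : gl ≤ g x :=
  hg.2.2 x ⟨fun i => (by have := hx.1 i; simp only at this ⊢; linarith),
    fun i => (by have := hx.2 i; simp only at this ⊢; linarith)⟩

theorem inv_g_le {g : (Fin 2 → ℝ) → ℝ} {gl : ℝ} (hgl : 0 < gl) (hg : DesignOK g gl)
    {x : Fin 2 → ℝ} (hx : x ∈ box) : (g x)⁻¹ ≤ gl⁻¹ :=
  inv_anti₀ hgl (le_g_of_mem_box hg hx)

theorem abs_Jfun_le (hK : KernelHyp P.K P.Q) (hgl : 0 < P.gl) (hg : DesignOK P.g P.gl)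
    (ht : ∀ i, |t i| ≤ 1 / 2) (hE : E ∈ Ecal (1/8) A) (x : Fin 2 → ℝ) :
    |Jfun P t E x| ≤ √A * Ksup P.K ^ 2 * P.gl⁻¹ := by
  have h0 : 0 ≤ √A * Ksup P.K ^ 2 * P.gl⁻¹ := by positivity
  by_cases hx : Jfun P t E x = 0
  · rw [hx]; simpa using h0
  · have hb := mem_box_of_Jfun_ne_zero hK ht hE hx
    rw [Jfun, abs_mul, abs_mul, abs_of_nonneg (Real.sqrt_nonneg _),
      abs_of_nonneg (inv_nonneg.2 (hg.1 x))]
    have := inv_g_le hgl hg hb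
    have h1 := Real.sqrt_le_sqrt hE.1
    have h2 := hK.abs_K2_le (E.mulVec (x - t))
    have h3 := inv_nonneg.2 (hg.1 x)
    gcongr

theorem abs_Jfun_sub_le (hK : KernelHyp P.K P.Q) (hgl : 0 < P.gl) (hg : DesignOK P.g P.gl)
    (ht : ∀ i, |t i| ≤ 1 / 2) (hE : E ∈ Ecal (1/8) A) (hE' : E' ∈ Ecal (1/8) A)
    {δ : ℝ} (hδ0 : 0 ≤ δ) (hδ1 : δ ≤ 1) (hd : ∀ i j, |E i j - E' i j| ≤ δ) (x : Fin 2 → ℝ) :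
    |Jfun P t E x - Jfun P t E' x| ≤ 36 * P.gl⁻¹ * P.Q ^ 2 * √A * √δ := by
  have hA : 0 ≤ A := (abs_nonneg _).trans hE.1
  have hQ := hK.Q_nonneg
  have hbox : x ∈ box ∨ (Jfun P t E x = 0 ∧ Jfun P t E' x = 0) := by
    by_contra! h
    by_cases hx : Jfun P t E x = 0
    · exact h.1 (mem_box_of_Jfun_ne_zero hK ht hE' (h.2 hx))
    · exact h.1 (mem_box_of_Jfun_ne_zero hK ht hE hx)
  rcases hbox with hx | ⟨h1, h2⟩
  swap
  · rw [h1, h2]; simp; positivity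
  have hy : ∀ i, |x i - t i| ≤ 3 := fun i => by
    have h1 := hx.1 i
    have h2 := hx.2 i
    have h3 := abs_le.1 (ht i)
    rw [abs_le]
    simp only at h1 h2
    constructor <;> linarith [h3.1, h3.2]
  have hu : ∀ i, |E.mulVec (x - t) i - E'.mulVec (x - t) i| ≤ 6 * δ := fun i => by
    have : E.mulVec (x - t) i - E'.mulVec (x - t) i =
        (E i 0 - E' i 0) * (x 0 - t 0) + (E i 1 - E' i 1) * (x 1 - t 1) := by
      simp only [Matrix.mulVec, dotProduct, Fin.sum_univ_two, Pi.sub_apply]; ring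
    rw [this]
    refine (abs_add_le _ _).trans ?_
    rw [abs_mul, abs_mul]
    have h0 := mul_le_mul (hd i 0) (hy 0) (abs_nonneg _) hδ0
    have h1 := mul_le_mul (hd i 1) (hy 1) (abs_nonneg _) hδ0
    linarith
  have hK2 : |K2 P.K (E.mulVec (x - t)) - K2 P.K (E'.mulVec (x - t))| ≤ 24 * P.Q ^ 2 * √δ := by
    refine (hK.abs_K2_sub_le _ _).trans ?_
    have h1 : Ksup P.K * P.Q ≤ 2 * P.Q ^ 2 := by nlinarith [hK.Ksup_le]
    have h2 : δ ≤ √δ := Real.le_sqrt_of_sq_le (by nlinarith)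
    calc Ksup P.K * P.Q * _ ≤ 2 * P.Q ^ 2 * (6 * √δ + 6 * √δ) := by
          refine mul_le_mul h1 ?_ (by positivity) (by positivity)
          have := hu 0
          have := hu 1
          linarith
      _ = _ := by ring
  have hent : ∀ {M : Matrix (Fin 2) (Fin 2) ℝ}, M ∈ Ecal (1/8) A → ∀ i j, |M i j| ≤ 2 * A :=
    fun hM i j => (abs_entry_le hM i j).trans (by linarith [hM.1])
  have hdet : |(|E.det| - |E'.det|)| ≤ 9 * (A * δ) := by
    refine (abs_abs_sub_abs_le _ _).trans ?_
    have : E.det - E'.det = E 0 0 * (E 1 1 - E' 1 1) + E' 1 1 * (E 0 0 - E' 0 0)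
        - (E 0 1 * (E 1 0 - E' 1 0) + E' 1 0 * (E 0 1 - E' 0 1)) := by
      rw [Matrix.det_fin_two, Matrix.det_fin_two]; ring
    rw [this]
    have m1 := mul_le_mul (hent hE 0 0) (hd 1 1) (abs_nonneg _) (by positivity)
    have m2 := mul_le_mul (hent hE' 1 1) (hd 0 0) (abs_nonneg _) (by positivity)
    have m3 := mul_le_mul (hent hE 0 1) (hd 1 0) (abs_nonneg _) (by positivity)
    have m4 := mul_le_mul (hent hE' 1 0) (hd 0 1) (abs_nonneg _) (by positivity)
    rw [← abs_mul] at m1 m2 m3 m4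
    have := abs_sub (E 0 0 * (E 1 1 - E' 1 1) + E' 1 1 * (E 0 0 - E' 0 0))
      (E 0 1 * (E 1 0 - E' 1 0) + E' 1 0 * (E 0 1 - E' 0 1))
    have := abs_add_le (E 0 0 * (E 1 1 - E' 1 1)) (E' 1 1 * (E 0 0 - E' 0 0))
    have := abs_add_le (E 0 1 * (E 1 0 - E' 1 0)) (E' 1 0 * (E 0 1 - E' 0 1))
    have : 0 ≤ A * δ := by positivity
    linarith
  have hsqrt_sub : ∀ a b : ℝ, 0 ≤ a → 0 ≤ b → |√a - √b| ≤ √|a - b| := by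
    intro a b ha hb
    refine Real.le_sqrt_of_sq_le ?_
    rw [sq_abs]
    have h1 := Real.sq_sqrt ha
    have h2 := Real.sq_sqrt hb
    have h3 := Real.sqrt_nonneg a
    have h4 := Real.sqrt_nonneg b
    rcases le_total (√a) (√b) with h | h
    · refine le_trans ?_ (neg_le_abs _); nlinarith
    · refine le_trans ?_ (le_abs_self _); nlinarith
  have hsq : |(√|E.det| - √|E'.det|)| ≤ 3 * (√A * √δ) := by
    refine (hsqrt_sub _ _ (abs_nonneg _) (abs_nonneg _)).trans ?_
    refine (Real.sqrt_le_sqrt hdet).trans ?_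
    rw [Real.sqrt_mul (by norm_num), Real.sqrt_mul hA,
      show (9 : ℝ) = 3 ^ 2 by norm_num, Real.sqrt_sq (by norm_num)]
  have hsplit : Jfun P t E x - Jfun P t E' x =
      (√|E.det| * (K2 P.K (E.mulVec (x - t)) - K2 P.K (E'.mulVec (x - t)))
        + K2 P.K (E'.mulVec (x - t)) * (√|E.det| - √|E'.det|)) * (P.g x)⁻¹ := by
    simp only [Jfun]; ring
  rw [hsplit, abs_mul, abs_of_nonneg (inv_nonneg.2 (hg.1 x))]
  have hb1 : |√|E.det| * (K2 P.K (E.mulVec (x - t)) - K2 P.K (E'.mulVec (x - t)))| ≤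
      √A * (24 * P.Q ^ 2 * √δ) := by
    rw [abs_mul, abs_of_nonneg (Real.sqrt_nonneg _)]
    exact mul_le_mul (Real.sqrt_le_sqrt hE.1) hK2 (abs_nonneg _) (Real.sqrt_nonneg _)
  have hb2 : |K2 P.K (E'.mulVec (x - t)) * (√|E.det| - √|E'.det|)| ≤
      (4 * P.Q ^ 2) * (3 * (√A * √δ)) := by
    rw [abs_mul]
    refine mul_le_mul ((hK.abs_K2_le _).trans ?_) hsq (abs_nonneg _) (by positivity)
    nlinarith [hK.Ksup_le, hK.one_le_Ksup]
  calc _ ≤ (√A * (24 * P.Q ^ 2 * √δ) + (4 * P.Q ^ 2) * (3 * (√A * √δ))) * P.gl⁻¹ := by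
        refine mul_le_mul ((abs_add_le _ _).trans (add_le_add hb1 hb2)) (inv_g_le hgl hg hx)
          (inv_nonneg.2 (hg.1 x)) (by positivity)
    _ = _ := by ring

theorem lintegral_Jfun_sq_mul_le (hK : KernelHyp P.K P.Q) (hgl : 0 < P.gl)
    (hg : DesignOK P.g P.gl) (ht : ∀ i, |t i| ≤ 1 / 2) (hE : E ∈ Ecal (1/8) A) :
    ∫⁻ x, ENNReal.ofReal (Jfun P t E x ^ 2 * P.g x) ≤ ENNReal.ofReal (P.gl⁻¹ * Ksup P.K ^ 4) := by
  by_cases hdet : E.det = 0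
  · simp [Jfun, hdet]
  have hd : 0 < |E.det| := abs_pos.2 hdet
  set S : Set (Fin 2 → ℝ) :=
    Set.Icc (fun _ : Fin 2 => (-(1/2) : ℝ)) (fun _ : Fin 2 => (1/2 : ℝ)) with hS
  set T : Set (Fin 2 → ℝ) := (fun x => x - t) ⁻¹' (Matrix.toLin' E ⁻¹' S) with hT
  have hEm : Measurable (Matrix.toLin' E) :=
    (LinearMap.continuous_of_finiteDimensional _).measurable
  have hTm : MeasurableSet T := (measurableSet_Icc.preimage hEm).preimage (by fun_prop)
  have hvolS : volume S = 1 := by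
    rw [hS, Real.volume_Icc_pi]
    norm_num
  have hvolT : volume T = ENNReal.ofReal |E.det|⁻¹ := by
    rw [hT, (measurePreserving_sub_right volume t).measure_preimage
      (measurableSet_Icc.preimage hEm).nullMeasurableSet, Measure.addHaar_preimage_linearMap _ (by
      simpa [LinearMap.det_toLin'] using hdet), hvolS, mul_one, LinearMap.det_toLin', abs_inv]
  have hpt : ∀ x, ENNReal.ofReal (Jfun P t E x ^ 2 * P.g x) ≤
      T.indicator (fun _ => ENNReal.ofReal (P.gl⁻¹ * Ksup P.K ^ 4 * |E.det|)) x := by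
    intro x
    by_cases hx : Jfun P t E x = 0
    · simp [hx]
    have hk : K2 P.K (E.mulVec (x - t)) ≠ 0 := by
      exact fun h => hx (by rw [Jfun, h]; ring)
    have hmem : x ∈ T := by
      have := hK.mem_of_K2_ne_zero hk
      exact ⟨fun i => (abs_le.1 (this i)).1, fun i => (abs_le.1 (this i)).2⟩
    rw [Set.indicator_of_mem hmem]
    refine ENNReal.ofReal_le_ofReal ?_
    have hb := mem_box_of_Jfun_ne_zero hK ht hE hx
    have hgx : 0 < P.g x := hgl.trans_le (le_g_of_mem_box hg hb)
    have : Jfun P t E x ^ 2 * P.g x = |E.det| * K2 P.K (E.mulVec (x - t)) ^ 2 * (P.g x)⁻¹ := by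
      simp only [Jfun, mul_pow, Real.sq_sqrt hd.le]
      field_simp
    rw [this]
    have h2 : K2 P.K (E.mulVec (x - t)) ^ 2 ≤ Ksup P.K ^ 4 := by
      have := pow_le_pow_left₀ (abs_nonneg _) (hK.abs_K2_le (E.mulVec (x - t))) 2
      rw [sq_abs] at this
      linarith [show (Ksup P.K ^ 2) ^ 2 = Ksup P.K ^ 4 by ring]
    calc _ ≤ |E.det| * Ksup P.K ^ 4 * P.gl⁻¹ := by
          have := inv_g_le hgl hg hb
          gcongr
      _ = _ := by ring
  refine (lintegral_mono hpt).trans ?_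
  rw [lintegral_indicator hTm, setLIntegral_const, hvolT, ← ENNReal.ofReal_mul (by positivity)]
  refine ENNReal.ofReal_le_ofReal (le_of_eq ?_)
  field_simp

end Weight

section Density

variable {X : Type*} [MeasureSpace X] {q : X → ℝ}

/-- The measure with Lebesgue density `q`. -/
def densityMeasure (q : X → ℝ) : Measure X := volume.withDensity fun x => ENNReal.ofReal (q x)

theorem aemeasurable_of_integral_eq_one (h1 : ∫ x, q x = 1) : AEMeasurable q :=
  (Integrable.of_integral_ne_zero (by rw [h1]; exact one_ne_zero)).aemeasurable

theorem isProbabilityMeasure_densityMeasure (h0 : ∀ x, 0 ≤ q x) (h1 : ∫ x, q x = 1) :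
    IsProbabilityMeasure (densityMeasure q) := by
  refine ⟨?_⟩
  rw [densityMeasure, withDensity_apply _ MeasurableSet.univ, Measure.restrict_univ,
    ← ofReal_integral_eq_lintegral_ofReal
      (Integrable.of_integral_ne_zero (by rw [h1]; exact one_ne_zero))
      (Filter.Eventually.of_forall h0), h1, ENNReal.ofReal_one]

theorem densityMeasure_absolutelyContinuous : densityMeasure q ≪ volume :=
  withDensity_absolutelyContinuous _ _

theorem integral_densityMeasure (h0 : ∀ x, 0 ≤ q x) (hq : AEMeasurable q) (u : X → ℝ) :
    ∫ x, u x ∂(densityMeasure q) = ∫ x, u x * q x := by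
  rw [densityMeasure, integral_withDensity_eq_integral_toReal_smul₀ hq.ennreal_ofReal
    (Filter.Eventually.of_forall fun _ => ENNReal.ofReal_lt_top)]
  refine integral_congr_ae (Filter.Eventually.of_forall fun x => ?_)
  simp only [ENNReal.toReal_ofReal (h0 x), smul_eq_mul]
  ring

end Density

section JointLaw

variable {g : (Fin 2 → ℝ) → ℝ} {p : ℝ → ℝ} {F : (Fin 2 → ℝ) → ℝ}

/-- The change of variables `(x, e) ↦ (x, F x + e)`. -/
def shear (hF : Measurable F) : ((Fin 2 → ℝ) × ℝ) ≃ᵐ ((Fin 2 → ℝ) × ℝ) where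
  toFun z := (z.1, F z.1 + z.2)
  invFun z := (z.1, z.2 - F z.1)
  left_inv z := by simp
  right_inv z := by simp
  measurable_toFun := by simp only [Equiv.coe_fn_mk]; fun_prop
  measurable_invFun := by simp only [Equiv.coe_fn_symm_mk]; fun_prop

theorem shear_apply (hF : Measurable F) (z : (Fin 2 → ℝ) × ℝ) :
    shear hF z = (z.1, F z.1 + z.2) := rfl

theorem measurePreserving_shear (hF : Measurable F) :
    MeasurePreserving (shear hF) volume volume := by
  refine (MeasurePreserving.id (volume : Measure (Fin 2 → ℝ))).skew_product
    (g := fun x e => F x + e) (μc := (volume : Measure ℝ)) (by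
      simp only [Function.uncurry_def]; fun_prop) (Filter.Eventually.of_forall fun x => ?_)
  exact (measurePreserving_add_left volume (F x)).map_eq

theorem jointLaw_eq_map (hF : Measurable F) (hg0 : ∀ x, 0 ≤ g x) (hg : AEMeasurable g)
    (hp : AEMeasurable p) :
    jointLaw g p F = ((densityMeasure g).prod (densityMeasure p)).map (shear hF) := by
  rw [densityMeasure, densityMeasure, prod_withDensity₀ hg.ennreal_ofReal hp.ennreal_ofReal]
  ext s hs
  rw [Measure.map_apply (shear hF).measurable hs,
    withDensity_apply _ ((shear hF).measurable hs), jointLaw, withDensity_apply _ hs,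
    ← (measurePreserving_shear hF).setLIntegral_comp_preimage_emb
      (shear hF).measurableEmbedding, Measure.volume_eq_prod]
  refine lintegral_congr fun z => ?_
  rw [shear_apply]
  simp only [add_sub_cancel_left]
  rw [ENNReal.ofReal_mul (hg0 _)]

theorem integral_jointLaw (hF : Measurable F) (hg0 : ∀ x, 0 ≤ g x) (hg : AEMeasurable g)
    (hp : AEMeasurable p) (u : (Fin 2 → ℝ) → ℝ) (h : ℝ → ℝ) :
    ∫ z, u z.1 * h (z.2 - F z.1) ∂(jointLaw g p F) =
      (∫ x, u x ∂(densityMeasure g)) * ∫ e, h e ∂(densityMeasure p) := by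
  have : SFinite (densityMeasure g) := by unfold densityMeasure; infer_instance
  have : SFinite (densityMeasure p) := by unfold densityMeasure; infer_instance
  rw [jointLaw_eq_map hF hg0 hg hp, (shear hF).measurableEmbedding.integral_map,
    ← integral_prod_mul]
  refine integral_congr_ae (Filter.Eventually.of_forall fun z => ?_)
  simp only [shear_apply, add_sub_cancel_left]

theorem isProbabilityMeasure_jointLaw (hF : Measurable F) (hg0 : ∀ x, 0 ≤ g x)
    (hg1 : ∫ x, g x = 1) (hp0 : ∀ x, 0 ≤ p x) (hp1 : ∫ x, p x = 1) :
    IsProbabilityMeasure (jointLaw g p F) := by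
  have := isProbabilityMeasure_densityMeasure hg0 hg1
  have := isProbabilityMeasure_densityMeasure hp0 hp1
  rw [jointLaw_eq_map hF hg0 (aemeasurable_of_integral_eq_one hg1)
    (aemeasurable_of_integral_eq_one hp1)]
  exact Measure.isProbabilityMeasure_map (shear hF).measurable.aemeasurable

theorem jointLaw_residual_mem (hF : Measurable F) (hg0 : ∀ x, 0 ≤ g x)
    (hg1 : ∫ x, g x = 1) (hp0 : ∀ x, 0 ≤ p x) (hp1 : ∫ x, p x = 1) {s : Set ℝ}
    (hs : MeasurableSet s) :
    jointLaw g p F {z | z.2 - F z.1 ∈ s} = densityMeasure p s := by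
  have := isProbabilityMeasure_densityMeasure hg0 hg1
  have := isProbabilityMeasure_densityMeasure hp0 hp1
  have hm : MeasurableSet {z : (Fin 2 → ℝ) × ℝ | z.2 - F z.1 ∈ s} :=
    measurableSet_preimage (by fun_prop : Measurable fun z : (Fin 2 → ℝ) × ℝ => z.2 - F z.1) hs
  rw [jointLaw_eq_map hF hg0 (aemeasurable_of_integral_eq_one hg1)
    (aemeasurable_of_integral_eq_one hp1), Measure.map_apply (shear hF).measurable hm]
  have : shear hF ⁻¹' {z | z.2 - F z.1 ∈ s} = Set.univ ×ˢ s := by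
    ext z
    simp [shear_apply]
  rw [this, Measure.prod_prod]
  simp

end JointLaw

section Noise

variable {p : ℝ → ℝ} {Υ Ωc ω : ℝ}

theorem noise_tail_le (hp : p ∈ NoiseClass Υ Ωc ω) {s : ℝ} (hs : 0 ≤ s) :
    densityMeasure p {x | s ≤ |x|} ≤ ENNReal.ofReal (2 * Υ * Real.exp (-Ωc * s ^ ω)) := by
  obtain ⟨h0, h1, hsymm, htail⟩ := hp
  have hint : Integrable p := Integrable.of_integral_ne_zero (by rw [h1]; exact one_ne_zero)
  have hIci : densityMeasure p (Set.Ici s) ≤ ENNReal.ofReal (Υ * Real.exp (-Ωc * s ^ ω)) := by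
    rw [densityMeasure, withDensity_apply _ measurableSet_Ici,
      ← ofReal_integral_eq_lintegral_ofReal hint.integrableOn
        (Filter.Eventually.of_forall h0)]
    exact ENNReal.ofReal_le_ofReal (htail s hs)
  have hIic : densityMeasure p (Set.Iic (-s)) = densityMeasure p (Set.Ici s) := by
    rw [densityMeasure, withDensity_apply _ measurableSet_Ici,
      withDensity_apply _ measurableSet_Iic,
      ← (Measure.measurePreserving_neg (volume : Measure ℝ)).setLIntegral_comp_preimage_emb
        (MeasurableEquiv.neg ℝ).measurableEmbedding]
    simp [hsymm]
  have hsub : {x : ℝ | s ≤ |x|} ⊆ Set.Ici s ∪ Set.Iic (-s) := by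
    intro x hx
    rcases le_abs.1 (show s ≤ |x| from hx) with h | h
    · exact Or.inl h
    · exact Or.inr (by simp only [Set.mem_Iic]; linarith)
  have hnn : 0 ≤ Υ * Real.exp (-Ωc * s ^ ω) :=
    (integral_nonneg h0).trans (htail s hs)
  calc _ ≤ _ := measure_mono hsub
    _ ≤ densityMeasure p (Set.Ici s) + densityMeasure p (Set.Iic (-s)) := measure_union_le _ _
    _ ≤ ENNReal.ofReal (Υ * Real.exp (-Ωc * s ^ ω)) +
        ENNReal.ofReal (Υ * Real.exp (-Ωc * s ^ ω)) := by
        rw [hIic]; exact add_le_add hIci hIci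
    _ = _ := by rw [← ENNReal.ofReal_add hnn hnn]; congr 1; ring

theorem summable_noise_tail (hΩ : 0 < Ωc) (hω : 0 < ω) :
    Summable fun k : ℕ => (2 * (k : ℝ) + 1) * (2 * Υ * Real.exp (-Ωc * (k : ℝ) ^ ω)) := by
  have h1 := (isLittleO_exp_neg_mul_rpow_atTop hΩ (-3 / ω)).comp_tendsto
    ((tendsto_rpow_atTop hω).comp tendsto_natCast_atTop_atTop)
  have h2 : (fun k : ℕ => Real.exp (-Ωc * (k : ℝ) ^ ω)) =O[Filter.atTop]
      fun k : ℕ => (k : ℝ) ^ (-3 : ℝ) := by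
    refine h1.isBigO.congr (fun k => rfl) (fun k => ?_)
    simp only [Function.comp]
    rw [← Real.rpow_mul (Nat.cast_nonneg k)]
    congr 1
    field_simp
  have h3 : (fun k : ℕ => 2 * (k : ℝ) + 1) =O[Filter.atTop] fun k : ℕ => (k : ℝ) := by
    refine Asymptotics.IsBigO.of_bound 3 ?_
    filter_upwards [Filter.eventually_ge_atTop 1] with k hk
    have : (1 : ℝ) ≤ k := by exact_mod_cast hk
    rw [Real.norm_eq_abs, Real.norm_eq_abs, abs_of_nonneg (by positivity),
      abs_of_nonneg (by positivity)]
    linarith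
  refine summable_of_isBigO_nat (g := fun k : ℕ => (k : ℝ) * (k : ℝ) ^ (-3 : ℝ)) ?_
    (h3.mul (h2.const_mul_left (2 * Υ)))
  refine (Real.summable_nat_rpow.2 (by norm_num : (-2 : ℝ) < -1)).congr fun k => ?_
  rcases eq_or_ne k 0 with rfl | hk
  · norm_num
  · have : (0 : ℝ) < k := by exact_mod_cast Nat.pos_of_ne_zero hk
    rw [show (-2 : ℝ) = 1 + (-3) by norm_num, Real.rpow_add this, Real.rpow_one]

theorem ofReal_sq_le_tsum (x : ℝ) : ENNReal.ofReal (x ^ 2) ≤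
    ∑' k : ℕ, {y : ℝ | (k : ℝ) ≤ |y|}.indicator (fun _ => ENNReal.ofReal (2 * (k : ℝ) + 1)) x := by
  set m := ⌊|x|⌋₊ + 1 with hm
  have hxm : |x| ≤ m := by rw [hm]; push_cast; exact (Nat.lt_floor_add_one _).le
  have hsum : ∀ m : ℕ, ∑ k ∈ Finset.range m, (2 * (k : ℝ) + 1) = (m : ℝ) ^ 2 := by
    intro m
    induction m with
    | zero => simp
    | succ k ih => rw [Finset.sum_range_succ, ih]; push_cast; ring
  calc ENNReal.ofReal (x ^ 2) ≤ ENNReal.ofReal (∑ k ∈ Finset.range m, (2 * (k : ℝ) + 1)) := by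
        refine ENNReal.ofReal_le_ofReal ?_
        rw [hsum, ← sq_abs]
        exact pow_le_pow_left₀ (abs_nonneg _) hxm 2
    _ = ∑ k ∈ Finset.range m, ENNReal.ofReal (2 * (k : ℝ) + 1) :=
        ENNReal.ofReal_sum_of_nonneg fun k _ => by positivity
    _ = ∑ k ∈ Finset.range m,
        {y : ℝ | (k : ℝ) ≤ |y|}.indicator (fun _ => ENNReal.ofReal (2 * (k : ℝ) + 1)) x := by
        refine Finset.sum_congr rfl fun k hk => ?_
        rw [Set.indicator_of_mem]
        have : k ≤ ⌊|x|⌋₊ := Nat.lt_succ_iff.1 (Finset.mem_range.1 hk)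
        exact (Nat.le_floor_iff (abs_nonneg x)).1 this
    _ ≤ _ := ENNReal.sum_le_tsum _

theorem lintegral_sq_mul_noise_le (hΥ : 0 < Υ) (hΩ : 0 < Ωc) (hω : 0 < ω)
    (hp : p ∈ NoiseClass Υ Ωc ω) :
    ∫⁻ x, ENNReal.ofReal (x ^ 2 * p x) ≤ ENNReal.ofReal
      (∑' k : ℕ, (2 * (k : ℝ) + 1) * (2 * Υ * Real.exp (-Ωc * (k : ℝ) ^ ω))) := by
  have hm : ∀ k : ℕ, MeasurableSet {y : ℝ | (k : ℝ) ≤ |y|} := fun k =>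
    measurableSet_le measurable_const (by fun_prop)
  have haem : AEMeasurable p := aemeasurable_of_integral_eq_one hp.2.1
  have h1 : ∫⁻ x, ENNReal.ofReal (x ^ 2 * p x) =
      ∫⁻ x, ENNReal.ofReal (x ^ 2) ∂(densityMeasure p) := by
    rw [densityMeasure, lintegral_withDensity_eq_lintegral_mul₀ haem.ennreal_ofReal
      (by fun_prop)]
    refine lintegral_congr fun x => ?_
    rw [Pi.mul_apply, ENNReal.ofReal_mul (sq_nonneg x), mul_comm]
  rw [h1]
  calc _ ≤ ∫⁻ x, ∑' k : ℕ, {y : ℝ | (k : ℝ) ≤ |y|}.indicator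
        (fun _ => ENNReal.ofReal (2 * (k : ℝ) + 1)) x ∂(densityMeasure p) :=
        lintegral_mono fun x => ofReal_sq_le_tsum x
    _ = ∑' k : ℕ, ENNReal.ofReal (2 * (k : ℝ) + 1) * densityMeasure p {y : ℝ | (k : ℝ) ≤ |y|} := by
        rw [lintegral_tsum fun k => (measurable_const.indicator (hm k)).aemeasurable]
        refine tsum_congr fun k => ?_
        rw [lintegral_indicator (hm k), setLIntegral_const]
    _ ≤ ∑' k : ℕ, ENNReal.ofReal
        ((2 * (k : ℝ) + 1) * (2 * Υ * Real.exp (-Ωc * (k : ℝ) ^ ω))) := by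
        refine ENNReal.tsum_le_tsum fun k => ?_
        rw [ENNReal.ofReal_mul (by positivity)]
        gcongr
        exact noise_tail_le hp (Nat.cast_nonneg k)
    _ = _ := (ENNReal.ofReal_tsum_of_nonneg (fun k => by positivity)
        (summable_noise_tail hΩ hω)).symm

theorem integrable_sq_mul_noise (hΥ : 0 < Υ) (hΩ : 0 < Ωc) (hω : 0 < ω)
    (hp : p ∈ NoiseClass Υ Ωc ω) : Integrable fun x => x ^ 2 * p x := by
  have haem : AEMeasurable p := aemeasurable_of_integral_eq_one hp.2.1
  refine ⟨(AEMeasurable.mul (by fun_prop) haem).aestronglyMeasurable, ?_⟩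
  rw [hasFiniteIntegral_iff_ofReal
    (Filter.Eventually.of_forall fun x => mul_nonneg (sq_nonneg x) (hp.1 x))]
  exact (lintegral_sq_mul_noise_le hΥ hΩ hω hp).trans_lt ENNReal.ofReal_lt_top

theorem integral_sq_mul_noise_le_sigma2 {P : Pars} (hΥ : 0 < P.Υ) (hΩ : 0 < P.Ωc) (hω : 0 < P.ω)
    (hp : p ∈ NoiseClass P.Υ P.Ωc P.ω) : ∫ x, x ^ 2 * p x ≤ sigma2 P := by
  refine le_csSup ⟨∑' k : ℕ, (2 * (k : ℝ) + 1) * (2 * P.Υ * Real.exp (-P.Ωc * (k : ℝ) ^ P.ω)), ?_⟩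
    ⟨p, hp, rfl⟩
  rintro _ ⟨q, hq, rfl⟩
  rw [integral_eq_lintegral_of_nonneg_ae
    (Filter.Eventually.of_forall fun x => mul_nonneg (sq_nonneg x) (hq.1 x))
    (integrable_sq_mul_noise hΥ hΩ hω hq).1]
  exact ENNReal.toReal_le_of_le_ofReal (tsum_nonneg fun k => by positivity)
    (lintegral_sq_mul_noise_le hΥ hΩ hω hq)

/-- Truncation of a real number to `0` outside `[-s, s]`. -/
def truncate (s e : ℝ) : ℝ := if |e| ≤ s then e else 0

theorem measurable_truncate (s : ℝ) : Measurable (truncate s) :=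
  Measurable.ite (measurableSet_le (by fun_prop) measurable_const) measurable_id measurable_const

theorem abs_truncate_le {s : ℝ} (hs : 0 ≤ s) (e : ℝ) : |truncate s e| ≤ s := by
  unfold truncate
  split_ifs with h
  · exact h
  · simpa using hs

theorem truncate_sq_le (s e : ℝ) : truncate s e ^ 2 ≤ e ^ 2 := by
  unfold truncate
  split_ifs with h
  · exact le_rfl
  · simpa using sq_nonneg e

theorem integral_truncate_eq_zero (hp : p ∈ NoiseClass Υ Ωc ω) (s : ℝ) :
    ∫ e, truncate s e ∂(densityMeasure p) = 0 := by
  rw [integral_densityMeasure hp.1 (aemeasurable_of_integral_eq_one hp.2.1)]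
  have h := integral_neg_eq_self (fun e => truncate s e * p e) volume
  have hodd : ∀ e, truncate s (-e) * p (-e) = -(truncate s e * p e) := by
    intro e
    rw [hp.2.2.1]
    unfold truncate
    rw [abs_neg]
    split_ifs <;> ring
  simp only [hodd, integral_neg] at h
  linarith

theorem integral_truncate_sq_le {P : Pars} (hΥ : 0 < P.Υ) (hΩ : 0 < P.Ωc) (hω : 0 < P.ω)
    (hp : p ∈ NoiseClass P.Υ P.Ωc P.ω) (s : ℝ) :
    ∫ e, truncate s e ^ 2 ∂(densityMeasure p) ≤ sigma2 P := by
  have haem : AEMeasurable p := aemeasurable_of_integral_eq_one hp.2.1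
  rw [integral_densityMeasure hp.1 haem]
  refine (integral_mono_of_nonneg (Filter.Eventually.of_forall fun e =>
    mul_nonneg (sq_nonneg _) (hp.1 e)) (integrable_sq_mul_noise hΥ hΩ hω hp)
    (Filter.Eventually.of_forall fun e => ?_)).trans
    (integral_sq_mul_noise_le_sigma2 hΥ hΩ hω hp)
  exact mul_le_mul_of_nonneg_right (truncate_sq_le s e) (hp.1 e)

end Noise

section Net

/-- A set of real `2 × 2` matrices with entries bounded by `N * δ` has a `δ`-net of at most
`(2 * N + 1) ^ 4` of its own elements. -/
theorem exists_finset_net {S : Set (Matrix (Fin 2) (Fin 2) ℝ)} {δ : ℝ} (hδ : 0 < δ) {N : ℕ}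
    (hS : ∀ E ∈ S, ∀ i j, |E i j| ≤ N * δ) :
    ∃ T : Finset (Matrix (Fin 2) (Fin 2) ℝ), (∀ E ∈ T, E ∈ S) ∧ T.card ≤ (2 * N + 1) ^ 4 ∧
      ∀ E ∈ S, ∃ E' ∈ T, ∀ i j, |E i j - E' i j| ≤ δ := by
  classical
  let key : Matrix (Fin 2) (Fin 2) ℝ → Fin 2 → Fin 2 → ℤ := fun E i j => ⌊E i j / δ⌋
  let keys : Finset (Fin 2 → Fin 2 → ℤ) :=
    Fintype.piFinset fun _ => Fintype.piFinset fun _ => Finset.Icc (-(N : ℤ)) N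
  have hkey : ∀ E ∈ S, key E ∈ keys := by
    intro E hE
    simp only [keys, key, Fintype.mem_piFinset, Finset.mem_Icc]
    intro i j
    have h := abs_le.1 (hS E hE i j)
    constructor
    · rw [Int.le_floor, le_div_iff₀ hδ]
      push_cast
      linarith [h.1]
    · have : (⌊E i j / δ⌋ : ℝ) ≤ N := (Int.floor_le _).trans ((div_le_iff₀ hδ).2 h.2)
      exact_mod_cast this
  have hcard : keys.card = (2 * N + 1) ^ 4 := by
    have : (Finset.Icc (-(N : ℤ)) N).card = 2 * N + 1 := by
      rw [Int.card_Icc]; omega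
    simp only [keys, Fintype.card_piFinset, this, Finset.prod_const, Finset.card_univ,
      Fintype.card_fin]
    ring
  let keys' := keys.filter fun k => ∃ E ∈ S, key E = k
  have hrep : ∀ k : Fin 2 → Fin 2 → ℤ, ∃ E, k ∈ keys' → E ∈ S ∧ key E = k := by
    intro k
    by_cases hk : k ∈ keys'
    · obtain ⟨E, hE, h⟩ := (Finset.mem_filter.1 hk).2
      exact ⟨E, fun _ => ⟨hE, h⟩⟩
    · exact ⟨0, fun h => absurd h hk⟩
  choose rep hrep using hrep
  refine ⟨keys'.image rep, ?_, ?_, ?_⟩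
  · intro E hE
    obtain ⟨k, hk, rfl⟩ := Finset.mem_image.1 hE
    exact (hrep k hk).1
  · exact Finset.card_image_le.trans ((Finset.card_filter_le _ _).trans hcard.le)
  · intro E hE
    have hk : key E ∈ keys' := Finset.mem_filter.2 ⟨hkey E hE, E, hE, rfl⟩
    refine ⟨rep (key E), Finset.mem_image_of_mem _ hk, fun i j => ?_⟩
    have h := congrFun (congrFun (hrep _ hk).2 i) j
    have h2 := Int.abs_sub_lt_one_of_floor_eq_floor h
    rw [← sub_div, abs_div, abs_of_pos hδ, div_lt_one hδ, abs_sub_comm] at h2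
    exact h2.le

/-- Union bound over a finite net for a process that varies little on its cells. -/
theorem measure_exists_le_of_net {I D : Type*} [MeasurableSpace D] {ν : Measure D}
    [IsFiniteMeasure ν] {S : Set I} {T : Finset I} {R : I → I → Prop} {Z : I → D → ℝ} {a κ q : ℝ}
    (hnet : ∀ E ∈ S, ∃ E' ∈ T, R E E')
    (hclose : ∀ E ∈ S, ∀ E' ∈ T, R E E' → ∀ d, |Z E d - Z E' d| ≤ κ)
    (htail : ∀ E ∈ T, ν.real {d | a ≤ |Z E d|} ≤ q) :
    ν.real {d | ∃ E ∈ S, a + κ ≤ |Z E d|} ≤ T.card * q := by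
  have hsub : {d | ∃ E ∈ S, a + κ ≤ |Z E d|} ⊆ ⋃ E ∈ T, {d | a ≤ |Z E d|} := by
    rintro d ⟨E, hE, h⟩
    obtain ⟨E', hE', hR⟩ := hnet E hE
    simp only [Set.mem_iUnion, Set.mem_ofPred_eq]
    refine ⟨E', hE', ?_⟩
    have h1 := hclose E hE E' hE' hR d
    have h2 := abs_sub_abs_le_abs_sub (Z E d) (Z E' d)
    linarith
  calc _ ≤ ν.real (⋃ E ∈ T, {d | a ≤ |Z E d|}) := measureReal_mono hsub (measure_ne_top _ _)
    _ ≤ ∑ E ∈ T, ν.real {d | a ≤ |Z E d|} := measureReal_biUnion_finset_le _ _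
    _ ≤ ∑ _E ∈ T, q := Finset.sum_le_sum htail
    _ = T.card * q := by rw [Finset.sum_const, nsmul_eq_mul]

end Net

section WeightedSums

variable {P : Pars} {t : Fin 2 → ℝ} {A : ℝ} {μ : Measure ((Fin 2 → ℝ) × ℝ)}

/-- The normalized centered sum of `J(X_i,E) H(X_i,Y_i)`. -/
def weightedProc (P : Pars) (t : Fin 2 → ℝ) (μ : Measure ((Fin 2 → ℝ) × ℝ))
    (H : (Fin 2 → ℝ) × ℝ → ℝ) (n : ℕ) (E : Matrix (Fin 2) (Fin 2) ℝ)
    (d : Fin n → (Fin 2 → ℝ) × ℝ) : ℝ :=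
  (n : ℝ) ^ (-(1/2) : ℝ) * ∑ i, (Jfun P t E (d i).1 * H (d i) - ∫ z, Jfun P t E z.1 * H z ∂μ)

theorem abs_sum_scaled_le {n : ℕ} (hn : 0 < n) {u : Fin n → ℝ} {B : ℝ} (hu : ∀ i, |u i| ≤ B) :
    |(n : ℝ) ^ (-(1/2) : ℝ) * ∑ i, u i| ≤ √n * B := by
  have hn0 : (0 : ℝ) < n := by exact_mod_cast hn
  rw [abs_mul, abs_of_nonneg (by positivity)]
  have h1 : |∑ i, u i| ≤ n * B := by
    refine (Finset.abs_sum_le_sum_abs _ _).trans ((Finset.sum_le_sum fun i _ => hu i).trans ?_)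
    simp
  calc _ ≤ (n : ℝ) ^ (-(1/2) : ℝ) * (n * B) := by gcongr
    _ = √n * B := by
        rw [← mul_assoc, Real.sqrt_eq_rpow]
        congr 1
        conv_lhs => rw [← Real.rpow_one (n : ℝ), ← Real.rpow_mul (by positivity)]
        rw [← Real.rpow_add hn0]; norm_num

theorem abs_weightedProc_sub_le [IsProbabilityMeasure μ] {n : ℕ} (hn : 0 < n)
    {H : (Fin 2 → ℝ) × ℝ → ℝ} {E E' : Matrix (Fin 2) (Fin 2) ℝ} {B : ℝ}
    (hi : Integrable (fun z => Jfun P t E z.1 * H z) μ)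
    (hi' : Integrable (fun z => Jfun P t E' z.1 * H z) μ)
    (hB : ∀ z, |Jfun P t E z.1 * H z - Jfun P t E' z.1 * H z| ≤ B)
    (d : Fin n → (Fin 2 → ℝ) × ℝ) :
    |weightedProc P t μ H n E d - weightedProc P t μ H n E' d| ≤ √n * (2 * B) := by
  rw [weightedProc, weightedProc, ← mul_sub, ← Finset.sum_sub_distrib]
  refine abs_sum_scaled_le hn fun i => ?_
  have hm : |∫ z, Jfun P t E z.1 * H z ∂μ - ∫ z, Jfun P t E' z.1 * H z ∂μ| ≤ B := by
    rw [← integral_sub hi hi']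
    have := norm_integral_le_of_norm_le_const (μ := μ) 
      (Filter.Eventually.of_forall fun z => (Real.norm_eq_abs _).trans_le (hB z))
    simpa using this
  have h1 := hB (d i)
  rw [abs_le] at *
  constructor <;> linarith [h1.1, h1.2, hm.1, hm.2]

set_option maxHeartbeats 800000 in
/-- Deviation bound, uniform over `Ecal (1/8) A`, for the process `weightedProc`. -/
theorem weightedProc_deviation (hK : KernelHyp P.K P.Q) (hgl : 0 < P.gl)
    (hg : DesignOK P.g P.gl) (ht : ∀ i, |t i| ≤ 1 / 2) [IsProbabilityMeasure μ] {n : ℕ}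
    (hn : 0 < n) (hA : 0 < A) (hAn : A ≤ n) {H : (Fin 2 → ℝ) × ℝ → ℝ} {G S v c L : ℝ}
    (hG1 : 1 ≤ G) (hG2 : G ^ 2 = P.gl⁻¹) (hv0 : 0 < v) (hc : 100 ≤ c)
    (hL1 : 32 * n * S ≤ L * v) (hL2 : 36 * P.gl⁻¹ * P.Q ^ 2 * n ≤ L ^ 2) (hL3 : 7 * n ≤ L)
    (hJ : ∀ E ∈ Ecal (1/8) A, AEMeasurable (fun z => Jfun P t E z.1 * H z) μ)
    (hH : ∀ z : (Fin 2 → ℝ) × ℝ, z.1 ∈ box → |H z| ≤ 16 * S)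
    (hS : 0 < S)
    (hb : ∀ E ∈ Ecal (1/8) A, ∀ z, |Jfun P t E z.1 * H z - ∫ z, Jfun P t E z.1 * H z ∂μ| ≤
      √A * Ksup P.K ^ 2 * P.gl⁻¹ * (16 * S))
    (hvar : ∀ E ∈ Ecal (1/8) A, ∫ z, (Jfun P t E z.1 * H z) ^ 2 ∂μ ≤
      P.gl⁻¹ * Ksup P.K ^ 4 * v ^ 2) :
    (Measure.pi fun _ : Fin n => μ).real {d | ∃ E ∈ Ecal (1/8) A,
      2 * √2 * (G * Ksup P.K ^ 2 * v) * √c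
        + √A * Ksup P.K ^ 2 * P.gl⁻¹ * (16 * S) * c / 6 * (n : ℝ) ^ (-(1/2) : ℝ) - v
        ≤ |weightedProc P t μ H n E d|} ≤ L ^ 28 * (2 * Real.exp (-(c / 2))) := by
  have hn1 : (1 : ℝ) ≤ n := by exact_mod_cast hn
  have hKs := hK.one_le_Ksup
  have hL0 : 1 ≤ L := by linarith
  have hLpos : 0 < L := by linarith
  set δ : ℝ := (L ^ 6)⁻¹ with hδ
  have hδ0 : 0 < δ := by positivity
  have hδ1 : δ ≤ 1 := inv_le_one_of_one_le₀ (one_le_pow₀ hL0)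
  have hsδ : √δ = (L ^ 3)⁻¹ := by
    rw [hδ, show (L ^ 6)⁻¹ = ((L ^ 3)⁻¹) ^ 2 by rw [← inv_pow, ← inv_pow]; ring]
    exact Real.sqrt_sq (by positivity)
  have hint : ∀ E ∈ Ecal (1/8) A, Integrable (fun z => Jfun P t E z.1 * H z) μ := by
    intro E hE
    refine Integrable.of_bound (hJ E hE).aestronglyMeasurable
      (√A * Ksup P.K ^ 2 * P.gl⁻¹ * (16 * S)) (Filter.Eventually.of_forall fun z => ?_)
    rw [Real.norm_eq_abs, abs_mul]
    by_cases hz : Jfun P t E z.1 = 0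
    · rw [hz]; simp; positivity
    · exact mul_le_mul (abs_Jfun_le hK hgl hg ht hE _)
        (hH z (mem_box_of_Jfun_ne_zero hK ht hE hz)) (abs_nonneg _) (by positivity)
  set N : ℕ := ⌈2 * n / δ⌉₊ with hN
  have hNb : (2 * n : ℝ) ≤ N * δ := by
    have := Nat.le_ceil (2 * n / δ : ℝ)
    rwa [div_le_iff₀ hδ0] at this
  obtain ⟨T, hTS, hTc, hTn⟩ := exists_finset_net (S := Ecal (1/8) A) hδ0 (N := N)
    (fun E hE i j => (abs_entry_le hE i j).trans (by linarith [hE.1]))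
  have hNL : (2 * N + 1 : ℝ) ≤ L ^ 7 := by
    have h1 : (N : ℝ) < 2 * n / δ + 1 := Nat.ceil_lt_add_one (by positivity)
    have h2 : (2 * n / δ : ℝ) = 2 * n * L ^ 6 := by rw [hδ, div_inv_eq_mul]
    rw [h2] at h1
    have h3 : 1 ≤ L ^ 6 := one_le_pow₀ hL0
    have h4 : (7 * n) * L ^ 6 ≤ L * L ^ 6 := by gcongr
    nlinarith [mul_le_mul hn1 h3 zero_le_one (by linarith)]
  have hcard : (T.card : ℝ) ≤ L ^ 28 := by
    calc (T.card : ℝ) ≤ ((2 * N + 1) ^ 4 : ℕ) := by exact_mod_cast hTc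
      _ = (2 * N + 1 : ℝ) ^ 4 := by push_cast; ring
      _ ≤ (L ^ 7) ^ 4 := by gcongr
      _ = L ^ 28 := by ring
  have hclose : ∀ E ∈ Ecal (1/8) A, ∀ E' ∈ T, (∀ i j, |E i j - E' i j| ≤ δ) → ∀ d,
      |weightedProc P t μ H n E d - weightedProc P t μ H n E' d| ≤ v := by
    intro E hE E' hE' hR d
    have hE'S := hTS E' hE'
    have hB : ∀ z : (Fin 2 → ℝ) × ℝ,
        |Jfun P t E z.1 * H z - Jfun P t E' z.1 * H z| ≤ L⁻¹ * (16 * S) := by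
      intro z
      by_cases hz : z.1 ∈ box
      · rw [← sub_mul, abs_mul]
        refine mul_le_mul ?_ (hH z hz) (abs_nonneg _) (by positivity)
        refine (abs_Jfun_sub_le hK hgl hg ht hE hE'S hδ0.le hδ1 hR _).trans ?_
        rw [hsδ, ← div_eq_mul_inv, div_le_iff₀ (by positivity)]
        have hsA : √A ≤ n := (Real.sqrt_le_left (by linarith)).2 (by nlinarith)
        calc _ ≤ 36 * P.gl⁻¹ * P.Q ^ 2 * n := by gcongr
          _ ≤ L ^ 2 := hL2
          _ = L⁻¹ * L ^ 3 := by field_simp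
      · have h1 : Jfun P t E z.1 = 0 :=
          not_not.1 fun h => hz (mem_box_of_Jfun_ne_zero hK ht hE h)
        have h2 : Jfun P t E' z.1 = 0 :=
          not_not.1 fun h => hz (mem_box_of_Jfun_ne_zero hK ht hE'S h)
        rw [h1, h2]; simp; positivity
    refine (abs_weightedProc_sub_le hn (hint E hE) (hint E' hE'S) hB d).trans ?_
    have hsn : √(n : ℝ) ≤ n := (Real.sqrt_le_left (by linarith)).2 (by nlinarith)
    calc √(n : ℝ) * (2 * (L⁻¹ * (16 * S))) ≤ n * (2 * (L⁻¹ * (16 * S))) := by gcongr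
      _ = (32 * n * S) / L := by field_simp; ring
      _ ≤ v := by rw [div_le_iff₀ hLpos]; linarith
  have hcpos : 0 < c := by linarith
  have hVpos : 0 < G * Ksup P.K ^ 2 * v := by positivity
  have htail : ∀ E ∈ T, (Measure.pi fun _ : Fin n => μ).real
      {d | 2 * (G * Ksup P.K ^ 2 * v) * √c +
        √A * Ksup P.K ^ 2 * P.gl⁻¹ * (16 * S) * c / 6 * (n : ℝ) ^ (-(1/2) : ℝ)
          ≤ |weightedProc P t μ H n E d|} ≤ 2 * Real.exp (-(c / 2)) := by
    intro E hE
    have hES := hTS E hE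
    set m := ∫ z, Jfun P t E z.1 * H z ∂μ with hm
    have hbpos : 0 < √A * Ksup P.K ^ 2 * P.gl⁻¹ * (16 * S) := by
      have : 0 < √A := Real.sqrt_pos.2 hA
      positivity
    have hvar' : ∫ z, (Jfun P t E z.1 * H z - m) ^ 2 ∂μ ≤ (G * Ksup P.K ^ 2 * v) ^ 2 := by
      have h1 := ProbabilityTheory.variance_le_expectation_sq (μ := μ)
        (X := fun z => Jfun P t E z.1 * H z) (hJ E hES).aestronglyMeasurable
      rw [ProbabilityTheory.variance_eq_integral (hJ E hES)] at h1
      calc _ ≤ _ := h1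
        _ ≤ P.gl⁻¹ * Ksup P.K ^ 4 * v ^ 2 := hvar E hES
        _ = _ := by rw [← hG2]; ring
    have hmean : ∫ z, (Jfun P t E z.1 * H z - m) ∂μ = 0 := by
      rw [integral_sub (hint E hES) (integrable_const _)]
      simp [hm]
    refine (measureReal_mono ?_ (measure_ne_top _ _)).trans
      (measure_abs_sum_ge_le hn ((hJ E hES).sub_const m) hbpos hVpos hcpos (hb E hES) hmean hvar')
    intro d hd
    have hd' : 2 * (G * Ksup P.K ^ 2 * v) * √c +
        √A * Ksup P.K ^ 2 * P.gl⁻¹ * (16 * S) * c / 6 * (n : ℝ) ^ (-(1/2) : ℝ)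
          ≤ |weightedProc P t μ H n E d| := hd
    have hn0 : (0 : ℝ) < n := by linarith
    rw [weightedProc, abs_mul, abs_of_nonneg (by positivity)] at hd'
    have hsn : (n : ℝ) ^ (-(1/2) : ℝ) = (√n)⁻¹ := by
      rw [Real.rpow_neg hn0.le, Real.sqrt_eq_rpow]
    have hsp : 0 < √(n : ℝ) := Real.sqrt_pos.2 hn0
    rw [hsn] at hd'
    have h3 := mul_le_mul_of_nonneg_left hd' hsp.le
    rw [mul_inv_cancel_left₀ hsp.ne'] at h3
    refine le_trans (le_of_eq ?_) h3
    field_simp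
  have hmain := measure_exists_le_of_net (ν := Measure.pi fun _ : Fin n => μ) hTn hclose htail
  refine (measureReal_mono ?_ (measure_ne_top _ _)).trans (hmain.trans ?_)
  · rintro d ⟨E, hE, h⟩
    refine ⟨E, hE, le_trans ?_ h⟩
    have h2 : (1.4 : ℝ) ≤ √2 := Real.le_sqrt_of_sq_le (by norm_num)
    have h3 : (10 : ℝ) ≤ √c := Real.le_sqrt_of_sq_le (by linarith)
    have h4 : v ≤ G * Ksup P.K ^ 2 * v := by
      have : 1 ≤ G * Ksup P.K ^ 2 := one_le_mul_of_one_le_of_one_le hG1 (one_le_pow₀ hKs)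
      nlinarith
    have h5 : 10 * v ≤ (G * Ksup P.K ^ 2 * v) * √c := by nlinarith
    have h6 := mul_le_mul_of_nonneg_right h2 (mul_nonneg hVpos.le (Real.sqrt_nonneg c))
    linarith
  · gcongr

end WeightedSums

section Moments

variable {P : Pars} {t : Fin 2 → ℝ} {A : ℝ} {E : Matrix (Fin 2) (Fin 2) ℝ} {p : ℝ → ℝ}
  {F : (Fin 2 → ℝ) → ℝ}

theorem aemeasurable_Jfun (hK : KernelHyp P.K P.Q) (hg : AEMeasurable P.g) :
    AEMeasurable (fun z : (Fin 2 → ℝ) × ℝ => Jfun P t E z.1) (jointLaw P.g p F) := by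
  have h1 : AEMeasurable (fun x => Jfun P t E x) := by
    have h2 : Continuous fun x : Fin 2 → ℝ => K2 P.K (E.mulVec (x - t)) := by
      have := hK.continuous_K2
      fun_prop
    exact (h2.measurable.aemeasurable.const_mul _).mul hg.inv
  have h3 : AEMeasurable (fun z : (Fin 2 → ℝ) × ℝ => Jfun P t E z.1) (volume.prod volume) :=
    h1.comp_quasiMeasurePreserving Measure.quasiMeasurePreserving_fst
  exact h3.mono_ac (withDensity_absolutelyContinuous _ _)

theorem integral_Jfun_sq_le (hK : KernelHyp P.K P.Q) (hgl : 0 < P.gl)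
    (hg : DesignOK P.g P.gl) (ht : ∀ i, |t i| ≤ 1 / 2) (hE : E ∈ Ecal (1/8) A) :
    ∫ x, Jfun P t E x ^ 2 ∂(densityMeasure P.g) ≤ P.gl⁻¹ * Ksup P.K ^ 4 := by
  have hgm := aemeasurable_of_integral_eq_one hg.2.1
  rw [integral_densityMeasure hg.1 hgm]
  by_cases hm : AEStronglyMeasurable (fun x => Jfun P t E x ^ 2 * P.g x) volume
  · rw [integral_eq_lintegral_of_nonneg_ae
      (Filter.Eventually.of_forall fun x => mul_nonneg (sq_nonneg _) (hg.1 x)) hm]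
    exact ENNReal.toReal_le_of_le_ofReal (by positivity)
      (lintegral_Jfun_sq_mul_le hK hgl hg ht hE)
  · rw [integral_non_aestronglyMeasurable hm]; positivity

theorem integrable_Jfun_sq (hK : KernelHyp P.K P.Q) (hgl : 0 < P.gl)
    (hg : DesignOK P.g P.gl) (ht : ∀ i, |t i| ≤ 1 / 2) (hE : E ∈ Ecal (1/8) A) :
    Integrable (fun x => Jfun P t E x ^ 2) (densityMeasure P.g) := by
  have := isProbabilityMeasure_densityMeasure hg.1 hg.2.1
  have h2 : Continuous fun x : Fin 2 → ℝ => K2 P.K (E.mulVec (x - t)) := by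
    have := hK.continuous_K2
    fun_prop
  have hm : AEMeasurable (fun x => Jfun P t E x) :=
    (h2.measurable.aemeasurable.const_mul _).mul (aemeasurable_of_integral_eq_one hg.2.1).inv
  refine Integrable.of_bound
    ((hm.mono_ac densityMeasure_absolutelyContinuous).pow_const 2).aestronglyMeasurable
    ((√A * Ksup P.K ^ 2 * P.gl⁻¹) ^ 2) (Filter.Eventually.of_forall fun x => ?_)
  rw [Real.norm_eq_abs, abs_pow]
  exact pow_le_pow_left₀ (abs_nonneg _) (abs_Jfun_le hK hgl hg ht hE x) 2

end Moments

section Constants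

/-- The argument of the logarithm in `c₁(n)` (`T = 1`) and in `c₂(n)` (`T = τ`). -/
def logArg (P : Pars) (n : ℕ) (T : ℝ) : ℝ :=
  16 * (n : ℝ) ^ 2 * T * P.gl ^ (-(1/2) : ℝ) * (12 * P.Q + √2)

variable {P : Pars} {n : ℕ} {T : ℝ}

theorem c1f_eq : c1f P n = 730 * Real.log (logArg P n 1) + 8 * P.r * Real.log n + 394 := by
  rw [c1f, logArg, mul_one]

theorem c2f_eq : c2f P n = 730 * Real.log (logArg P n (tauf P n)) + 8 * P.r * Real.log n + 394 :=
  rfl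

theorem one_le_rpow_gl (hgl : P.gl ∈ Set.Ioo (0 : ℝ) 1) : 1 ≤ P.gl ^ (-(1/2) : ℝ) :=
  Real.one_le_rpow_of_pos_of_le_one_of_nonpos hgl.1 hgl.2.le (by norm_num)

theorem rpow_gl_sq (hgl : 0 < P.gl) : (P.gl ^ (-(1/2) : ℝ)) ^ 2 = P.gl⁻¹ := by
  rw [← Real.rpow_natCast, ← Real.rpow_mul hgl.le, ← Real.rpow_neg_one]
  norm_num

theorem le_logArg (hQ : 0 ≤ P.Q) (hgl : P.gl ∈ Set.Ioo (0 : ℝ) 1) (hn : 3 ≤ n) (hT : 1 ≤ T) :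
    32 * n * T ≤ logArg P n T ∧ 36 * P.gl⁻¹ * P.Q ^ 2 * n ≤ logArg P n T ^ 2 := by
  have hn' : (3 : ℝ) ≤ n := by exact_mod_cast hn
  have hG := one_le_rpow_gl hgl
  have h2 : (1 : ℝ) ≤ √2 := Real.one_le_sqrt.2 (by norm_num)
  constructor
  · have h3 : 1 ≤ P.gl ^ (-(1/2) : ℝ) * (12 * P.Q + √2) :=
      one_le_mul_of_one_le_of_one_le hG (by linarith)
    have h4 : 32 * (n : ℝ) * T ≤ 16 * (n : ℝ) ^ 2 * T := by
      nlinarith [mul_pos (by linarith : (0 : ℝ) < n) (by linarith : 0 < T)]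
    calc 32 * (n : ℝ) * T ≤ 16 * (n : ℝ) ^ 2 * T := h4
      _ = 16 * (n : ℝ) ^ 2 * T * 1 := by ring
      _ ≤ 16 * (n : ℝ) ^ 2 * T * (P.gl ^ (-(1/2) : ℝ) * (12 * P.Q + √2)) := by gcongr
      _ = _ := by rw [logArg]; ring
  · have h5 : 192 * (n : ℝ) ^ 2 * P.gl ^ (-(1/2) : ℝ) * P.Q ≤ logArg P n T := by
      calc _ = 16 * (n : ℝ) ^ 2 * 1 * P.gl ^ (-(1/2) : ℝ) * (12 * P.Q + 0) := by ring
        _ ≤ _ := by rw [logArg]; gcongr; positivity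
    have h6 : (192 * (n : ℝ) ^ 2 * P.gl ^ (-(1/2) : ℝ) * P.Q) ^ 2 ≤ logArg P n T ^ 2 := by
      gcongr
    refine le_trans ?_ h6
    have h7 : (n : ℝ) ≤ n ^ 4 := by
      calc (n : ℝ) = n ^ 1 := (pow_one _).symm
        _ ≤ n ^ 4 := pow_le_pow_right₀ (by linarith) (by norm_num)
    have hgl0 := hgl.1
    calc 36 * P.gl⁻¹ * P.Q ^ 2 * n ≤ 36864 * P.gl⁻¹ * P.Q ^ 2 * n ^ 4 := by gcongr; norm_num
      _ = _ := by rw [← rpow_gl_sq hgl.1]; ring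

theorem pow_mul_exp_neg_le {L : ℝ} (hL : 1 ≤ L) (hn : 0 < n) (r : ℝ) :
    L ^ 28 * (2 * Real.exp (-((730 * Real.log L + 8 * r * Real.log n + 394) / 2))) ≤
      2 * (n : ℝ) ^ (-(4 * r)) := by
  have hn0 : (0 : ℝ) < n := by exact_mod_cast hn
  have h1 : L ^ 28 = Real.exp (28 * Real.log L) := by
    rw [mul_comm, Real.exp_mul, Real.exp_log (by linarith)]
    norm_cast
  rw [h1, Real.rpow_def_of_pos hn0, mul_left_comm, ← Real.exp_add]
  gcongr
  have := Real.log_nonneg hL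
  linarith

theorem one_le_log (hn : 3 ≤ n) : 1 ≤ Real.log n := by
  have hn' : (3 : ℝ) ≤ n := by exact_mod_cast hn
  rw [Real.le_log_iff_exp_le (by linarith)]
  linarith [Real.exp_one_lt_three]

theorem hmin_pos {ω : ℝ} (hn : 3 ≤ n) : 0 < hmin ω n := by
  have := one_le_log hn
  have hn0 : (0 : ℝ) < n := by exact_mod_cast (by omega : 0 < n)
  unfold hmin
  positivity

theorem inv_hmin_le {ω : ℝ} (hω : 0 < ω) (hn : 3 ≤ n) : (hmin ω n)⁻¹ ≤ n := by
  have := one_le_log hn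
  have hn0 : (0 : ℝ) < n := by exact_mod_cast (by omega : 0 < n)
  rw [inv_le_comm₀ (hmin_pos hn) hn0, hmin]
  exact le_mul_of_one_le_right (by positivity) (Real.one_le_rpow this (by positivity))

theorem sqrt_inv_hmin {ω : ℝ} (hω : 0 < ω) (hn : 3 ≤ n) :
    √((hmin ω n)⁻¹) * (n : ℝ) ^ (-(1/2) : ℝ) = Real.log n ^ (-((2 + ω) / (2 * ω))) := by
  have := one_le_log hn
  have hn0 : (0 : ℝ) < n := by exact_mod_cast (by omega : 0 < n)
  rw [hmin, mul_inv, inv_inv, Real.sqrt_mul hn0.le, Real.sqrt_eq_rpow, Real.sqrt_eq_rpow,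
    ← Real.rpow_neg (by positivity), ← Real.rpow_mul (by positivity), mul_right_comm,
    ← Real.rpow_add hn0]
  norm_num
  congr 1
  field_simp
  ring

theorem one_le_tauf (hΩ : P.Ωc ∈ Set.Ioc (0 : ℝ) 1) (hω : 0 < P.ω) (hr : 1 ≤ P.r) (hn : 3 ≤ n) :
    1 ≤ tauf P n := by
  refine Real.one_le_rpow ?_ (by positivity)
  have h1 := one_le_log hn
  have h2 : 1 ≤ P.Ωc⁻¹ := (one_le_inv₀ hΩ.1).2 hΩ.2
  exact one_le_mul_of_one_le_of_one_le
    (one_le_mul_of_one_le_of_one_le h2 (by linarith)) h1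

theorem log_rpow_mul_tauf (hΩ : P.Ωc ∈ Set.Ioc (0 : ℝ) 1) (hω : 0 < P.ω) (hr : 1 ≤ P.r)
    (hn : 3 ≤ n) : Real.log n ^ (-((2 + P.ω) / (2 * P.ω))) * tauf P n =
      Real.log n ^ (-(1/2) : ℝ) * (P.Ωc⁻¹ * (4 * P.r + 1)) ^ ((1 : ℝ) / P.ω) := by
  have h1 := one_le_log hn
  have h2 := hΩ.1
  rw [tauf, Real.mul_rpow (by positivity) (by positivity), mul_left_comm, ← Real.rpow_add
    (by linarith), mul_comm]
  congr 2
  field_simp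
  ring

end Constants

section Deviation

variable {P : Pars} {n : ℕ} {t : Fin 2 → ℝ} {p : ℝ → ℝ} {F : (Fin 2 → ℝ) → ℝ}

theorem etaProc_eq_weightedProc (hF : Measurable F) (hg : DesignOK P.g P.gl)
    (hp : p ∈ NoiseClass P.Υ P.Ωc P.ω) (E : Matrix (Fin 2) (Fin 2) ℝ)
    (d : Fin n → (Fin 2 → ℝ) × ℝ) :
    etaProc P n t F E d = weightedProc P t (jointLaw P.g p F) (fun z => F z.1) n E d := by
  have hgm := aemeasurable_of_integral_eq_one hg.2.1
  have hpm := aemeasurable_of_integral_eq_one hp.2.1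
  have := isProbabilityMeasure_densityMeasure hp.1 hp.2.1
  have h := integral_jointLaw hF hg.1 hgm hpm (fun x => Jfun P t E x * F x) (fun _ => 1)
  simp only [mul_one, integral_const, smul_eq_mul, probReal_univ] at h
  rw [etaProc, weightedProc, h, integral_densityMeasure hg.1 hgm]

theorem etaProc_deviation (hK : KernelHyp P.K P.Q) (hgl : P.gl ∈ Set.Ioo (0 : ℝ) 1)
    (hg : DesignOK P.g P.gl) (ht : ∀ i, |t i| ≤ 1 / 2) (hω : 0 < P.ω) (hr : 1 ≤ P.r)
    (hn : 3 ≤ n) (hF : Measurable F) (hp : p ∈ NoiseClass P.Υ P.Ωc P.ω) {v : ℝ} (hv : 0 ≤ v)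
    (hFv : ∀ x ∈ box, |F x| ≤ v) :
    (dataLaw n P.g p F).real
      {d | ∃ E ∈ Ecal (1/8) ((hmin P.ω n)⁻¹), C1f P n * v < |etaProc P n t F E d|} ≤
        2 * (n : ℝ) ^ (-(4 * P.r)) := by
  have hgm := aemeasurable_of_integral_eq_one hg.2.1
  have hpm := aemeasurable_of_integral_eq_one hp.2.1
  have hpP := isProbabilityMeasure_densityMeasure hp.1 hp.2.1
  have hgP := isProbabilityMeasure_densityMeasure hg.1 hg.2.1
  have hμ := isProbabilityMeasure_jointLaw hF hg.1 hg.2.1 hp.1 hp.2.1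
  have hn0 : 0 < n := by omega
  have hn1 : (3 : ℝ) ≤ n := by exact_mod_cast hn
  have hgl0 := hgl.1
  set A := (hmin P.ω n)⁻¹ with hA
  have hA0 : 0 < A := inv_pos.2 (hmin_pos hn)
  set B := √A * Ksup P.K ^ 2 * P.gl⁻¹ with hB
  have hJF : ∀ E ∈ Ecal (1/8) A, ∀ x, |Jfun P t E x * F x| ≤ B * v := by
    intro E hE x
    rw [abs_mul]
    by_cases hz : Jfun P t E x = 0
    · rw [hz]; simp; positivity
    · exact mul_le_mul (abs_Jfun_le hK hgl0 hg ht hE _)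
        (hFv x (mem_box_of_Jfun_ne_zero hK ht hE hz)) (abs_nonneg _) (by positivity)
  have hm : ∀ E ∈ Ecal (1/8) A, |∫ z, Jfun P t E z.1 * F z.1 ∂(jointLaw P.g p F)| ≤ B * v := by
    intro E hE
    have := norm_integral_le_of_norm_le_const (μ := jointLaw P.g p F)
      (f := fun z => Jfun P t E z.1 * F z.1) (Filter.Eventually.of_forall fun z =>
        (Real.norm_eq_abs _).trans_le (hJF E hE z.1))
    simpa using this
  rcases hv.eq_or_lt with rfl | hvpos
  · have : {d : Fin n → (Fin 2 → ℝ) × ℝ | ∃ E ∈ Ecal (1/8) A,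
        C1f P n * 0 < |etaProc P n t F E d|} = ∅ := by
      refine Set.eq_empty_iff_forall_notMem.2 ?_
      rintro d ⟨E, hE, h⟩
      rw [etaProc_eq_weightedProc hF hg hp, weightedProc] at h
      have h1 : ∀ x, Jfun P t E x * F x = 0 := fun x => abs_nonpos_iff.1
        ((hJF E hE x).trans (mul_zero B).le)
      simp [h1] at h
    rw [this, measureReal_empty]
    positivity
  obtain ⟨hL1, hL2⟩ := le_logArg hK.Q_nonneg hgl hn (T := 1) le_rfl
  set L := logArg P n 1 with hL
  have hL0 : 1 ≤ L := by linarith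
  have hc : 100 ≤ c1f P n := by
    rw [c1f_eq]
    have h1 := Real.log_nonneg hL0
    have h2 := one_le_log hn
    have : 0 ≤ P.r * Real.log n := by positivity
    linarith
  have hdev := weightedProc_deviation (μ := jointLaw P.g p F) (H := fun z => F z.1) (S := v)
    (v := v) (c := c1f P n) (L := L) hK hgl0 hg ht hn0 hA0 (inv_hmin_le hω hn)
    (one_le_rpow_gl hgl) (rpow_gl_sq hgl0) hvpos hc (by nlinarith) hL2 (by linarith)
    (fun E _ => (aemeasurable_Jfun hK hgm).mul (hF.comp measurable_fst).aemeasurable)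
    (fun z hz => (hFv _ hz).trans (by linarith)) hvpos
    (fun E hE z => by
      refine (abs_sub _ _).trans ((add_le_add (hJF E hE z.1) (hm E hE)).trans ?_)
      have : 0 ≤ B * v := by positivity
      linarith)
    (fun E hE => by
      have h := integral_jointLaw hF hg.1 hgm hpm (fun x => (Jfun P t E x * F x) ^ 2) (fun _ => 1)
      simp only [mul_one, integral_const, smul_eq_mul, probReal_univ] at h
      rw [h]
      calc _ ≤ ∫ x, Jfun P t E x ^ 2 * v ^ 2 ∂(densityMeasure P.g) := by
            refine integral_mono_of_nonneg (Filter.Eventually.of_forall fun x => sq_nonneg _)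
              ((integrable_Jfun_sq hK hgl0 hg ht hE).mul_const _)
              (Filter.Eventually.of_forall fun x => ?_)
            simp only
            rw [mul_pow]
            by_cases hz : Jfun P t E x = 0
            · rw [hz]; simp
            · rw [← sq_abs (F x)]
              have := hFv x (mem_box_of_Jfun_ne_zero hK ht hE hz)
              gcongr
        _ = (∫ x, Jfun P t E x ^ 2 ∂(densityMeasure P.g)) * v ^ 2 := integral_mul_const _ _
        _ ≤ _ := by gcongr; exact integral_Jfun_sq_le hK hgl0 hg ht hE)
  rw [dataLaw]
  refine (measureReal_mono ?_ (measure_ne_top _ _)).trans (hdev.trans ?_)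
  · rintro d ⟨E, hE, h⟩
    refine ⟨E, hE, ?_⟩
    rw [etaProc_eq_weightedProc hF hg hp] at h
    refine le_trans ?_ h.le
    have hs := sqrt_inv_hmin hω hn
    rw [← hA] at hs
    rw [C1f, ← hs]
    refine (sub_le_self _ hv).trans (le_of_eq ?_)
    ring
  · rw [c1f_eq]
    exact pow_mul_exp_neg_le hL0 hn0 P.r

theorem xiProc_eq_weightedProc (hF : Measurable F) (hg : DesignOK P.g P.gl)
    (hp : p ∈ NoiseClass P.Υ P.Ωc P.ω) (E : Matrix (Fin 2) (Fin 2) ℝ) {s : ℝ}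
    {d : Fin n → (Fin 2 → ℝ) × ℝ} (hd : ∀ i, |(d i).2 - F (d i).1| ≤ s) :
    xiProc P n t F E d =
      weightedProc P t (jointLaw P.g p F) (fun z => truncate s (z.2 - F z.1)) n E d := by
  have hgm := aemeasurable_of_integral_eq_one hg.2.1
  have hpm := aemeasurable_of_integral_eq_one hp.2.1
  rw [xiProc, weightedProc, integral_jointLaw hF hg.1 hgm hpm, integral_truncate_eq_zero hp]
  simp only [mul_zero, sub_zero]
  congr 1
  exact Finset.sum_congr rfl fun i _ => by rw [truncate, if_pos (hd i)]

theorem xiProc_deviation (hK : KernelHyp P.K P.Q) (hgl : P.gl ∈ Set.Ioo (0 : ℝ) 1)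
    (hg : DesignOK P.g P.gl) (ht : ∀ i, |t i| ≤ 1 / 2) (hΥ : 0 < P.Υ)
    (hΩ : P.Ωc ∈ Set.Ioc (0 : ℝ) 1) (hω : 0 < P.ω) (hr : 1 ≤ P.r)
    (hn : 3 ≤ n) (hF : Measurable F) (hp : p ∈ NoiseClass P.Υ P.Ωc P.ω) :
    (dataLaw n P.g p F).real
      {d | ∃ E ∈ Ecal (1/8) ((hmin P.ω n)⁻¹), C2f P n - 1 ≤
        |weightedProc P t (jointLaw P.g p F)
          (fun z => truncate (16 * tauf P n) (z.2 - F z.1)) n E d|} ≤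
        2 * (n : ℝ) ^ (-(4 * P.r)) := by
  have hgm := aemeasurable_of_integral_eq_one hg.2.1
  have hpm := aemeasurable_of_integral_eq_one hp.2.1
  have hμ := isProbabilityMeasure_jointLaw hF hg.1 hg.2.1 hp.1 hp.2.1
  have hn0 : 0 < n := by omega
  have hn1 : (3 : ℝ) ≤ n := by exact_mod_cast hn
  have hgl0 := hgl.1
  set A := (hmin P.ω n)⁻¹ with hA
  have hA0 : 0 < A := inv_pos.2 (hmin_pos hn)
  have hτ := one_le_tauf hΩ hω hr hn
  set τ := tauf P n with hτdef
  set v := max (√(sigma2 P)) 1 with hv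
  have hv1 : 1 ≤ v := le_max_right _ _
  have hσ : ∫ e, truncate (16 * τ) e ^ 2 ∂(densityMeasure p) ≤ v ^ 2 := by
    have h0 := integral_truncate_sq_le hΥ hΩ.1 hω hp (16 * τ)
    refine h0.trans ?_
    calc sigma2 P ≤ √(sigma2 P) ^ 2 := by
          rw [Real.sq_sqrt ((integral_nonneg fun _ => sq_nonneg _).trans h0)]
      _ ≤ v ^ 2 := by gcongr; exact le_max_left _ _
  have hmean : ∀ E : Matrix (Fin 2) (Fin 2) ℝ, ∫ z, Jfun P t E z.1 *
      truncate (16 * τ) (z.2 - F z.1) ∂(jointLaw P.g p F) = 0 := fun E => by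
    rw [integral_jointLaw hF hg.1 hgm hpm, integral_truncate_eq_zero hp, mul_zero]
  obtain ⟨hL1, hL2⟩ := le_logArg hK.Q_nonneg hgl hn hτ
  set L := logArg P n τ with hL
  have hnτ : (n : ℝ) ≤ n * τ := le_mul_of_one_le_right (by linarith) hτ
  have hL0 : 1 ≤ L := by linarith
  have hc : 100 ≤ c2f P n := by
    rw [c2f_eq]
    have h1 := Real.log_nonneg hL0
    have h2 := one_le_log hn
    have : 0 ≤ P.r * Real.log n := by positivity
    linarith
  have hdev := weightedProc_deviation (μ := jointLaw P.g p F)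
    (H := fun z => truncate (16 * τ) (z.2 - F z.1)) (S := τ)
    (v := v) (c := c2f P n) (L := L) hK hgl0 hg ht hn0 hA0 (inv_hmin_le hω hn)
    (one_le_rpow_gl hgl) (rpow_gl_sq hgl0) (by linarith) hc (by nlinarith) hL2 (by linarith)
    (fun E _ => (aemeasurable_Jfun hK hgm).mul
      ((measurable_truncate _).comp (by fun_prop)).aemeasurable)
    (fun z _ => abs_truncate_le (by linarith) _) (by linarith)
    (fun E hE z => by
      rw [hmean, sub_zero, abs_mul]
      exact mul_le_mul (abs_Jfun_le hK hgl0 hg ht hE _) (abs_truncate_le (by linarith) _)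
        (abs_nonneg _) (by positivity))
    (fun E hE => by
      simp only [mul_pow]
      rw [integral_jointLaw hF hg.1 hgm hpm (fun x => Jfun P t E x ^ 2)
        (fun e => truncate (16 * τ) e ^ 2)]
      exact mul_le_mul (integral_Jfun_sq_le hK hgl0 hg ht hE) hσ
        (integral_nonneg fun _ => sq_nonneg _) (by positivity))
  rw [dataLaw]
  refine (measureReal_mono ?_ (measure_ne_top _ _)).trans (hdev.trans ?_)
  · rintro d ⟨E, hE, h⟩
    refine ⟨E, hE, le_trans ?_ h⟩
    have hs := sqrt_inv_hmin hω hn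
    rw [← hA] at hs
    have hlt := log_rpow_mul_tauf hΩ hω hr hn
    rw [← hs, ← hτdef] at hlt
    refine sub_le_sub (le_of_eq ?_) hv1
    rw [C2f, ← hv]
    linear_combination (8 / 3 * c2f P n * P.gl⁻¹ * Ksup P.K ^ 2) * hlt
  · rw [c2f_eq]
    exact pow_mul_exp_neg_le hL0 hn0 P.r

/-- When `h_min ≤ 8`, `16 ^ ω` exceeds `1` by a margin sufficient to absorb a factor `2`. -/
theorem log_two_le_of_hmin_le (hω : 0 < P.ω) (hr : 1 ≤ P.r) (hn : 3 ≤ n)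
    (h8 : hmin P.ω n ≤ 8) :
    (4 * P.r + 1) * Real.log n + Real.log 2 ≤ 16 ^ P.ω * ((4 * P.r + 1) * Real.log n) := by
  have hn1 : (3 : ℝ) ≤ n := by exact_mod_cast hn
  have h3 := Real.log_three_gt_d9
  have hl : Real.log 3 ≤ Real.log n := Real.log_le_log (by norm_num) hn1
  have hl0 : 0 < Real.log n := by linarith
  set ℓ := Real.log n with hℓ
  have hll : 0.08 ≤ Real.log ℓ := by
    have := Real.one_sub_inv_le_log_of_pos hl0
    have h5 : ℓ⁻¹ ≤ (1.0986 : ℝ)⁻¹ := inv_anti₀ (by norm_num) (by linarith)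
    norm_num at h5 ⊢
    linarith
  have hlog8 : Real.log 8 = 3 * Real.log 2 := by
    rw [show (8 : ℝ) = 2 ^ 3 by norm_num, Real.log_pow]; norm_num
  have hlog16 : Real.log 16 = 4 * Real.log 2 := by
    rw [show (16 : ℝ) = 2 ^ 4 by norm_num, Real.log_pow]; norm_num
  have h2a := Real.log_two_gt_d9
  have h2b := Real.log_two_lt_d9
  have hlog : (1 + 2 / P.ω) * Real.log ℓ ≤ 3 * Real.log 2 + ℓ := by
    have h := Real.log_le_log (hmin_pos hn) h8
    rw [hmin, Real.log_mul (by positivity) (by positivity), Real.log_inv,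
      Real.log_rpow hl0, hlog8] at h
    linarith
  have hω2 : 2 * Real.log ℓ ≤ P.ω * (3 * ℓ) := by
    have h := mul_le_mul_of_nonneg_left hlog hω.le
    have h6 : P.ω * ((1 + 2 / P.ω) * Real.log ℓ) = P.ω * Real.log ℓ + 2 * Real.log ℓ := by
      field_simp
    rw [h6] at h
    nlinarith
  have h16 : 1 + P.ω * (4 * Real.log 2) ≤ 16 ^ P.ω := by
    rw [Real.rpow_def_of_pos (by norm_num), hlog16]
    have := Real.add_one_le_exp (4 * Real.log 2 * P.ω)
    linarith
  have hbase : 5 * ℓ ≤ (4 * P.r + 1) * ℓ := by nlinarith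
  have key : Real.log 2 ≤ P.ω * (4 * Real.log 2) * (5 * ℓ) := by
    nlinarith [mul_le_mul_of_nonneg_right hω2 (by linarith : 0 ≤ Real.log 2)]
  have hω4 : 0 ≤ P.ω * (4 * Real.log 2) := by positivity
  nlinarith [mul_le_mul_of_nonneg_left hbase hω4,
    mul_le_mul_of_nonneg_right h16 (by linarith : 0 ≤ (4 * P.r + 1) * ℓ)]

theorem exists_large_noise_le (hΥ : 0 < P.Υ) (hΩ : P.Ωc ∈ Set.Ioc (0 : ℝ) 1) (hω : 0 < P.ω)
    (hr : 1 ≤ P.r) (hn : 3 ≤ n) (h8 : hmin P.ω n ≤ 8) (hg : DesignOK P.g P.gl)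
    (hF : Measurable F) (hp : p ∈ NoiseClass P.Υ P.Ωc P.ω) :
    dataLaw n P.g p F {d | ∃ i, 16 * tauf P n < |(d i).2 - F (d i).1|} ≤
      ENNReal.ofReal (P.Υ * (n : ℝ) ^ (-(4 * P.r))) := by
  have hμ := isProbabilityMeasure_jointLaw hF hg.1 hg.2.1 hp.1 hp.2.1
  have hn0 : (0 : ℝ) < n := by exact_mod_cast (by omega : 0 < n)
  have hl := one_le_log hn
  have hτ := one_le_tauf hΩ hω hr hn
  have hΩ0 := hΩ.1
  have hms : MeasurableSet {e : ℝ | 16 * tauf P n ≤ |e|} :=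
    measurableSet_le measurable_const (by fun_prop)
  have hm : MeasurableSet {z : (Fin 2 → ℝ) × ℝ | z.2 - F z.1 ∈ {e : ℝ | 16 * tauf P n ≤ |e|}} :=
    measurableSet_preimage (by fun_prop : Measurable fun z : (Fin 2 → ℝ) × ℝ => z.2 - F z.1) hms
  have hone : ∀ i : Fin n, dataLaw n P.g p F {d | 16 * tauf P n < |(d i).2 - F (d i).1|} ≤
      ENNReal.ofReal (2 * P.Υ * Real.exp (-P.Ωc * (16 * tauf P n) ^ P.ω)) := by
    intro i
    have h1 := (measurePreserving_eval (fun _ : Fin n => jointLaw P.g p F) i).measure_preimage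
      hm.nullMeasurableSet
    rw [jointLaw_residual_mem hF hg.1 hg.2.1 hp.1 hp.2.1 hms] at h1
    refine le_trans (measure_mono ?_) (h1.le.trans (noise_tail_le hp (by linarith)))
    intro d hd
    exact le_of_lt (show 16 * tauf P n < |(d i).2 - F (d i).1| from hd)
  have hτω : P.Ωc * (16 * tauf P n) ^ P.ω = 16 ^ P.ω * ((4 * P.r + 1) * Real.log n) := by
    rw [tauf, Real.mul_rpow (by norm_num) (by positivity), ← Real.rpow_mul (by positivity),
      one_div_mul_cancel hω.ne', Real.rpow_one]
    field_simp
  have hexp : n * (2 * P.Υ * Real.exp (-P.Ωc * (16 * tauf P n) ^ P.ω)) ≤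
      P.Υ * (n : ℝ) ^ (-(4 * P.r)) := by
    rw [neg_mul, hτω]
    calc _ ≤ n * (2 * P.Υ * Real.exp (-((4 * P.r + 1) * Real.log n + Real.log 2))) := by
          gcongr
          exact log_two_le_of_hmin_le hω hr hn h8
      _ = _ := by
          rw [neg_add, Real.exp_add, Real.exp_neg (Real.log 2), Real.exp_log (by norm_num),
            show -((4 * P.r + 1) * Real.log n) = Real.log n * (-(4 * P.r)) + -Real.log n by ring,
            Real.exp_add, Real.exp_neg (Real.log n), Real.exp_log hn0, Real.rpow_def_of_pos hn0]
          field_simp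
  calc _ = dataLaw n P.g p F (⋃ i, {d | 16 * tauf P n < |(d i).2 - F (d i).1|}) := by
        congr 1; ext d; simp
    _ ≤ ∑ i, dataLaw n P.g p F {d | 16 * tauf P n < |(d i).2 - F (d i).1|} :=
        measure_iUnion_fintype_le _ _
    _ ≤ ∑ _i : Fin n, ENNReal.ofReal (2 * P.Υ * Real.exp (-P.Ωc * (16 * tauf P n) ^ P.ω)) :=
        Finset.sum_le_sum fun i _ => hone i
    _ = ENNReal.ofReal (n * (2 * P.Υ * Real.exp (-P.Ωc * (16 * tauf P n) ^ P.ω))) := by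
        rw [Finset.sum_const, Finset.card_univ, Fintype.card_fin, nsmul_eq_mul,
          ENNReal.ofReal_mul hn0.le, ENNReal.ofReal_natCast]
    _ ≤ _ := ENNReal.ofReal_le_ofReal hexp

end Deviation

section Final

variable {P : Pars} {n : ℕ}

theorem continuous_of_mem_HolderBall {β₀ M : ℝ} (hβ₀ : 0 < β₀) {f : ℝ → ℝ}
    (hf : f ∈ HolderBall β₀ M) : Continuous f := by
  obtain ⟨A, B, -, -, hB⟩ := hf
  refine continuous_iff_continuousAt.2 fun x => tendsto_iff_dist_tendsto_zero.2 ?_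
  have h : Filter.Tendsto (fun y => B * |y - x| ^ β₀) (nhds x) (nhds 0) := by
    have : Continuous fun y => B * |y - x| ^ β₀ :=
      continuous_const.mul ((by fun_prop : Continuous fun y => |y - x|).rpow_const
        fun _ => Or.inr hβ₀.le)
    simpa [hβ₀.ne'] using this.tendsto x
  exact squeeze_zero (fun _ => dist_nonneg) (fun y => by rw [Real.dist_eq]; exact hB y x) h

theorem abs_le_FsupNorm {F : (Fin 2 → ℝ) → ℝ} {A : ℝ} (hA : ∀ x, |F x| ≤ A)
    {x : Fin 2 → ℝ} (hx : x ∈ box) : |F x| ≤ FsupNorm F :=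
  le_csSup ⟨A, by rintro _ ⟨y, -, rfl⟩; exact hA y⟩ ⟨x, hx, rfl⟩

theorem FsupNorm_nonneg (F : (Fin 2 → ℝ) → ℝ) : 0 ≤ FsupNorm F :=
  Real.sSup_nonneg (by rintro _ ⟨y, -, rfl⟩; exact abs_nonneg _)

theorem c1f_nonneg (hK : KernelHyp P.K P.Q) (hgl : P.gl ∈ Set.Ioo (0 : ℝ) 1) (hr : 1 ≤ P.r)
    (hn : 3 ≤ n) : 0 ≤ c1f P n := by
  have hn1 : (3 : ℝ) ≤ n := by exact_mod_cast hn
  have hL := (le_logArg hK.Q_nonneg hgl hn (T := 1) le_rfl).1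
  have h1 := Real.log_nonneg (by linarith : 1 ≤ logArg P n 1)
  have h2 := one_le_log hn
  rw [c1f_eq]
  positivity

theorem C1f_nonneg (hK : KernelHyp P.K P.Q) (hgl : P.gl ∈ Set.Ioo (0 : ℝ) 1) (hr : 1 ≤ P.r)
    (hn : 3 ≤ n) : 0 ≤ C1f P n := by
  have hgl0 := hgl.1
  have h1 := c1f_nonneg hK hgl hr hn
  have h2 := one_le_log hn
  unfold C1f
  positivity

theorem one_le_C2f (hK : KernelHyp P.K P.Q) (hgl : P.gl ∈ Set.Ioo (0 : ℝ) 1)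
    (hΩ : P.Ωc ∈ Set.Ioc (0 : ℝ) 1) (hω : 0 < P.ω) (hr : 1 ≤ P.r) (hn : 3 ≤ n) :
    1 ≤ C2f P n := by
  have hn1 : (3 : ℝ) ≤ n := by exact_mod_cast hn
  have hgl0 := hgl.1
  have hΩ0 := hΩ.1
  have hτ := one_le_tauf hΩ hω hr hn
  have hL := (le_logArg hK.Q_nonneg hgl hn hτ).1
  have hnτ : (n : ℝ) ≤ n * tauf P n := le_mul_of_one_le_right (by linarith) hτ
  have h1 := Real.log_nonneg (by linarith : 1 ≤ logArg P n (tauf P n))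
  have h2 := one_le_log hn
  have hc : 1 ≤ c2f P n := by
    rw [c2f_eq]
    have : 0 ≤ P.r * Real.log n := by positivity
    linarith
  have h3 : 1 ≤ 2 * √2 := by
    have : (1 : ℝ) ≤ √2 := Real.one_le_sqrt.2 (by norm_num)
    linarith
  have h4 : 1 ≤ 2 * √2 * max (√(sigma2 P)) 1 * P.gl ^ (-(1/2) : ℝ) * Ksup P.K ^ 2
      * √(c2f P n) :=
    one_le_mul_of_one_le_of_one_le (one_le_mul_of_one_le_of_one_le
      (one_le_mul_of_one_le_of_one_le (one_le_mul_of_one_le_of_one_le h3 (le_max_right _ _))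
        (one_le_rpow_gl hgl)) (one_le_pow₀ hK.one_le_Ksup)) (Real.one_le_sqrt.2 hc)
  have h5 : 0 ≤ 8 / 3 * c2f P n * Real.log n ^ (-(1/2) : ℝ) * P.gl⁻¹ * Ksup P.K ^ 2
      * (P.Ωc⁻¹ * (4 * P.r + 1)) ^ ((1 : ℝ) / P.ω) := by positivity
  unfold C2f
  linarith

end Final

/-- Lemma 2: under Assumptions 1–4, for any `n ≥ 3` and `r ≥ 1`,
`P(sup_{E ∈ ℰ*}[|η_{n,t}(E)| + |ξ_{n,t}(E)|] ≥ C₁(n)‖F‖_∞ + C₂(n)) ≤ (8+Υ) n^{-4r}`,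
where `ℰ* = ℰ_{1/8, h_min⁻¹}`. -/
theorem empirical_process_deviation
    (P : Pars) (β₀ M : ℝ)
    (hβ₀ : β₀ ∈ Set.Ioo (0 : ℝ) 1) (hM : 0 < M)
    (hΥ : 0 < P.Υ) (hΩc : P.Ωc ∈ Set.Ioc (0 : ℝ) 1) (hω : 0 < P.ω)
    (hK : KernelHyp P.K P.Q)
    (hgl : P.gl ∈ Set.Ioo (0 : ℝ) 1) (hg : DesignOK P.g P.gl)
    (hr : 1 ≤ P.r)
    (n : ℕ) (hn : 3 ≤ n)
    (f : ℝ → ℝ) (hf : f ∈ HolderBall β₀ M)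
    (θ : Fin 2 → ℝ) (hθ : θ ∈ S1)
    (p : ℝ → ℝ) (hp : p ∈ NoiseClass P.Υ P.Ωc P.ω)
    (t : Fin 2 → ℝ)
    (ht : t ∈ Set.Icc (fun _ : Fin 2 => -(1/2 : ℝ)) (fun _ : Fin 2 => (1/2 : ℝ))) :
    dataLaw n P.g p (fun x => f (dot2 x θ))
        {d | C1f P n * FsupNorm (fun x => f (dot2 x θ)) + C2f P n
          ≤ sSup {v | ∃ E ∈ Ecal (1/8) ((hmin P.ω n)⁻¹),
              v = |etaProc P n t (fun x => f (dot2 x θ)) E d|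
                + |xiProc P n t (fun x => f (dot2 x θ)) E d|}}
      ≤ ENNReal.ofReal ((8 + P.Υ) * (n : ℝ) ^ (-(4 * P.r))) := by
  have ht' : ∀ i, |t i| ≤ 1 / 2 := fun i => abs_le.2 ⟨ht.1 i, ht.2 i⟩
  have hfc := continuous_of_mem_HolderBall hβ₀.1 hf
  set F : (Fin 2 → ℝ) → ℝ := fun x => f (dot2 x θ) with hFdef
  have hF : Measurable F := by
    have : Continuous F := hfc.comp (by unfold dot2; fun_prop)
    exact this.measurable
  have hFb : ∀ x ∈ box, |F x| ≤ FsupNorm F := by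
    obtain ⟨A, B, -, hA, -⟩ := hf
    exact fun x hx => abs_le_FsupNorm (F := F) (fun y => hA _) hx
  have hF0 := FsupNorm_nonneg F
  have hC1 := mul_nonneg (C1f_nonneg hK hgl hr hn) hF0
  have hC2 := one_le_C2f hK hgl hΩc hω hr hn
  rcases le_or_gt (hmin P.ω n) 8 with h8 | h8
  · have hμ := isProbabilityMeasure_jointLaw hF hg.1 hg.2.1 hp.1 hp.2.1
    have hD : IsProbabilityMeasure (dataLaw n P.g p F) := by unfold dataLaw; infer_instance
    have hη := etaProc_deviation hK hgl hg ht' hω hr hn hF hp hF0 hFb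
    have hξ := xiProc_deviation hK hgl hg ht' hΥ hΩc hω hr hn hF hp
    have hε := exists_large_noise_le hΥ hΩc hω hr hn h8 hg hF hp
    rw [measureReal_def, ← ENNReal.le_ofReal_iff_toReal_le (measure_ne_top _ _) (by positivity)]
      at hη hξ
    refine (measure_mono ?_).trans ((measure_union_le _ _).trans (add_le_add
      ((measure_union_le _ _).trans (add_le_add hη hξ)) hε)) |>.trans ?_
    · intro d hd
      by_contra hcon
      simp only [Set.mem_union, Set.mem_ofPred_eq, not_or, not_exists, not_and, not_lt,
        not_le] at hcon hd
      obtain ⟨⟨hη', hξ'⟩, hε'⟩ := hcon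
      have : sSup {v | ∃ E ∈ Ecal (1/8) ((hmin P.ω n)⁻¹),
          v = |etaProc P n t F E d| + |xiProc P n t F E d|} ≤
          C1f P n * FsupNorm F + (C2f P n - 1) := by
        refine Real.sSup_le ?_ (by linarith)
        rintro _ ⟨E, hE, rfl⟩
        rw [xiProc_eq_weightedProc hF hg hp E hε']
        exact add_le_add (hη' E hE) (hξ' E hE).le
      linarith
    · rw [← ENNReal.ofReal_add (by positivity) (by positivity),
        ← ENNReal.ofReal_add (by positivity) (by positivity)]
      refine ENNReal.ofReal_le_ofReal ?_
      have : 0 ≤ (n : ℝ) ^ (-(4 * P.r)) := by positivity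
      linarith
  · have hE0 : ∀ E ∈ Ecal (1/8) ((hmin P.ω n)⁻¹), E = 0 := by
      intro E hE
      refine (eq_zero_or_le_abs_det hE).resolve_right fun h => ?_
      have h1 : (hmin P.ω n)⁻¹ < 8⁻¹ := inv_strictAnti₀ (by norm_num) h8
      have := hE.1
      linarith
    refine (measure_mono_null ?_ measure_empty).trans_le zero_le
    intro d hd
    have hd' : C1f P n * FsupNorm F + C2f P n ≤ sSup {v | ∃ E ∈ Ecal (1/8) ((hmin P.ω n)⁻¹),
          v = |etaProc P n t F E d| + |xiProc P n t F E d|} := hd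
    have : sSup {v | ∃ E ∈ Ecal (1/8) ((hmin P.ω n)⁻¹),
          v = |etaProc P n t F E d| + |xiProc P n t F E d|} ≤ 0 := by
      refine Real.sSup_le ?_ le_rfl
      rintro _ ⟨E, hE, rfl⟩
      rw [hE0 E hE]
      simp [etaProc, xiProc, Jfun]
    exact absurd (hd'.trans this) (by linarith)

end SingleIndex
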